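/- arXiv:1306.5879 — 3 statements merged into one kernel-verified Lean document; each statement's English description precedes it below -/
import Mathlib

section
/- Let γ := 1.0321, p := γ^{40}, q := γ^{31}, s₁ := (1/p)/(1 − 2/q + 2(1−1/q)/q^{39}), s₂ := (1 − 2/p)/(1/q − 2(1−1/q)/q^{39}), and for real s put s* := (p(q−1)/(q(p−1)))·s. Define the family of return maps: for finite 0–1 sequences (a_k)_{k=0}^{30} and (b_k)_{k=0}^{39}, T(t) := p^{31} t − (p−1)p^{30}( Σ_{k=0}^{30} a_k/p^k − s* Σ_{k=0}^{39} b_k/q^k ). Define I_s^− := [a₁,b₁] ∪ [a₂^−,b₂^−] ∪ [a₃,b₃] and I_s^+ := [a₁,b₁] ∪ [a₂^+,b₂^+] ∪ [a₃,b₃], where a₁ = −(q(p−1)/(p(q−1)))s* + (1−1/p)s*/q^{39}, b₁ = 1/p − (1−1/p)(1+1/q^{39})s*, a₂^− = −((p−1)/(p(q−1)))s* + (1−1/p)s*/q^{39}, b₂^− = 1 − (1−1/p)(1+1/q^{39})s*, a₂^+ = 1 − 1/p − (q(p−1)/(p(q−1)))s* + (1−1/p)s*/q^{39}, b₂^+ =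 1/p − (1−1/p)s*/q^{39}, a₃ = 1 − 1/p − ((p−1)/(p(q−1)))s* + (1−1/p)s*/q^{39}, b₃ = 1 − (1−1/p)s*/q^{39}. Then: for every s with s₁ ≤ s ≤ q(p−1)/(p(q−1)), the set I_s^− is recurrent for this family of maps (i.e. every t ∈ I_s^− is sent into the interior of I_s^− by some map of the family); and for every s with q(p−1)/(p(q−1)) < s ≤ s₂, the set I_s^+ is recurrent for this family. -/
/-- The points `x` that some choice of `m` binary digits in base `p` and `n` binary digits in
base `q` translates into the interior of `I`. -/
def digitCover (p q s : ℝ) (I : Set ℝ) (m n : ℕ) : Set ℝ :=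
  {x | ∃ a b : ℕ → ℝ, (∀ k, a k = 0 ∨ a k = 1) ∧ (∀ k, b k = 0 ∨ b k = 1) ∧
    x - (p - 1) * ∑ i ∈ Finset.range m, a i * p ^ i
      + s * (q - 1) * ∑ j ∈ Finset.range n, b j * q ^ j ∈ interior I}

lemma mem_digitCover_zero {p q s x : ℝ} {I : Set ℝ} (hx : x ∈ interior I) :
    x ∈ digitCover p q s I 0 0 :=
  ⟨fun _ => 0, fun _ => 0, by simp, by simp, by simpa using hx⟩

lemma sum_range_succ_update (a : ℕ → ℝ) (r e : ℝ) (m : ℕ) :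
    ∑ i ∈ Finset.range (m + 1), Function.update a m e i * r ^ i
      = ∑ i ∈ Finset.range m, a i * r ^ i + e * r ^ m := by
  rw [Finset.sum_range_succ, Function.update_self]
  congr 1
  refine Finset.sum_congr rfl fun i hi => ?_
  rw [Function.update_of_ne (Finset.mem_range.1 hi).ne]

lemma update_digit {a : ℕ → ℝ} (ha : ∀ k, a k = 0 ∨ a k = 1) {e : ℝ} (he : e = 0 ∨ e = 1)
    (m k : ℕ) : Function.update a m e k = 0 ∨ Function.update a m e k = 1 := by
  rcases eq_or_ne k m with rfl | h
  · simpa using he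
  · simpa [Function.update_of_ne h] using ha k

lemma digitCover_succ_left {p q s x : ℝ} {I : Set ℝ} {m n : ℕ} {e : ℝ} (he : e = 0 ∨ e = 1)
    (hx : x - e * ((p - 1) * p ^ m) ∈ digitCover p q s I m n) :
    x ∈ digitCover p q s I (m + 1) n := by
  obtain ⟨a, b, ha, hb, h⟩ := hx
  refine ⟨Function.update a m e, b, update_digit ha he m, hb, ?_⟩
  rw [sum_range_succ_update]
  convert h using 1
  ring

lemma digitCover_succ_right {p q s x : ℝ} {I : Set ℝ} {m n : ℕ} {e : ℝ} (he : e = 0 ∨ e = 1)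
    (hx : x + e * (s * (q - 1) * q ^ n) ∈ digitCover p q s I m n) :
    x ∈ digitCover p q s I m (n + 1) := by
  obtain ⟨a, b, ha, hb, h⟩ := hx
  refine ⟨a, Function.update b n e, ha, update_digit hb he n, ?_⟩
  rw [sum_range_succ_update]
  convert h using 1
  ring

lemma pow_mul_sum_reflect {r : ℝ} (hr : r ≠ 0) (a : ℕ → ℝ) (N : ℕ) :
    r ^ N * ∑ k ∈ Finset.range (N + 1), a (N - k) / r ^ k
      = ∑ i ∈ Finset.range (N + 1), a i * r ^ i := by
  rw [← Finset.sum_range_reflect (fun i => a i * r ^ i), Finset.mul_sum]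
  refine Finset.sum_congr rfl fun k hk => ?_
  have hk' : k ≤ N := Nat.lt_succ_iff.1 (Finset.mem_range.1 hk)
  have : r ^ N = r ^ (N - k) * r ^ k := by rw [← pow_add, Nat.sub_add_cancel hk']
  simp only [Nat.add_sub_cancel]
  rw [this]
  field_simp

/-- `S` contains `[A, B]` up to small neighbourhoods of the endpoints, a copy of `G` near `A`
and a copy of `G` near `B`. -/
def CoversOffGaps (G : Set ℝ) (s : ℝ) (S : Set ℝ) (A B : ℝ) : Prop :=
  ∀ x, A + 1 / 1000 ≤ x → x ≤ B - 1 / 1000 → x - (A + s) ∉ G → x - (B - 1) ∉ G → x ∈ S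

/-- Two intervals with overlap of length `o` can be merged without losing the gaps. -/
structure MergeableOverlap (G : Set ℝ) (s o : ℝ) : Prop where
  pos : 1 / 500 ≤ o
  right_gap : ∀ g ∈ G, 1 + 1 / 1000 - o < g
  left_gap : ∀ g ∈ G, g + s + 1 / 1000 < o
  disjoint : ∀ g ∈ G, ∀ g' ∈ G, g' - g ≠ o - 1 - s

lemma CoversOffGaps.merge {G S S' T : Set ℝ} {s A B A' B' : ℝ} (hL : CoversOffGaps G s S A B)
    (hR : CoversOffGaps G s S' A' B') (hS : S ⊆ T) (hS' : S' ⊆ T)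
    (ho : MergeableOverlap G s (B - A')) : CoversOffGaps G s T A B' := by
  intro x hA hB hxA hxB
  have h0 := ho.pos
  rcases lt_or_ge x (A' + 1 / 1000) with h | h
  · refine hS (hL x hA (by linarith) hxA fun hg => ?_)
    linarith [ho.right_gap _ hg]
  rcases lt_or_ge (B - 1 / 1000) x with h' | h'
  · refine hS' (hR x h hB (fun hg => ?_) hxB)
    linarith [ho.left_gap _ hg]
  by_cases hg : x - (B - 1) ∈ G
  · refine hS' (hR x h hB (fun hg' => ho.disjoint _ hg _ hg' (by ring)) hxB)
  · exact hS (hL x hA h' hxA hg)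

lemma CoversOffGaps.succ_left {G I : Set ℝ} {p q s : ℝ} {m n : ℕ}
    (h : CoversOffGaps G s (digitCover p q s I m n) (-(s * q ^ n)) (p ^ m))
    (ho : MergeableOverlap G s (s * q ^ n - (p - 2) * p ^ m)) :
    CoversOffGaps G s (digitCover p q s I (m + 1) n) (-(s * q ^ n)) (p ^ (m + 1)) := by
  refine CoversOffGaps.merge (A' := -(s * q ^ n) + (p - 1) * p ^ m)
    (S' := {x | x - (p - 1) * p ^ m ∈ digitCover p q s I m n}) h ?_ ?_ ?_ ?_
  · intro x hA hB hxA hxB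
    refine h _ (by linarith) (by rw [pow_succ] at hB; linarith) ?_ ?_
    · convert hxA using 2; ring
    · convert hxB using 2; ring
  · exact fun x hx => digitCover_succ_left (.inl rfl) (by simpa using hx)
  · exact fun x hx => digitCover_succ_left (.inr rfl) (by simpa using hx)
  · convert ho using 1; ring

lemma CoversOffGaps.succ_right {G I : Set ℝ} {p q s : ℝ} {m n : ℕ}
    (h : CoversOffGaps G s (digitCover p q s I m n) (-(s * q ^ n)) (p ^ m))
    (ho : MergeableOverlap G s (p ^ m - s * (q - 2) * q ^ n)) :
    CoversOffGaps G s (digitCover p q s I m (n + 1)) (-(s * q ^ (n + 1))) (p ^ m) := by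
  refine CoversOffGaps.merge (B := p ^ m - s * (q - 1) * q ^ n)
    (S := {x | x + s * (q - 1) * q ^ n ∈ digitCover p q s I m n}) ?_ h ?_ ?_ ?_
  · intro x hA hB hxA hxB
    refine h _ (by rw [pow_succ] at hA; linarith) (by linarith) ?_ ?_
    · convert hxA using 2; ring
    · convert hxB using 2; ring
  · exact fun x hx => digitCover_succ_right (.inr rfl) (by simpa using hx)
  · exact fun x hx => digitCover_succ_right (.inl rfl) (by simpa using hx)
  · convert ho using 1; ring

/-- The two gaps left between the intervals of the recurrent set, where `d` is the length
trimmed off at each endpoint. -/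
def gapSet (p q s d : ℝ) : Set ℝ :=
  Set.Icc (1 / p - (1 - 1 / q) * s - d) (min (-(s / q)) (1 - 1 / p - s) + d) ∪
    Set.Icc (max (1 / p) (1 - (1 - 1 / q) * s) - d) (1 - 1 / p - s / q + d)

lemma of_mem_gapSet {p q s d g : ℝ} (hg : g ∈ gapSet p q s d) :
    (1 / p - s + s / q - d ≤ g ∧ g ≤ -(s / q) + d ∧ g ≤ 1 - 1 / p - s + d) ∨
      (1 / p - d ≤ g ∧ 1 - s + s / q - d ≤ g ∧ g ≤ 1 - 1 / p - s / q + d) := by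
  have e : (1 - 1 / q) * s = s - s / q := by ring
  rw [gapSet, e] at hg
  rcases hg with ⟨h₁, h₂⟩ | ⟨h₁, h₂⟩
  · exact .inl ⟨by linarith, by linarith [min_le_left (-(s / q)) (1 - 1 / p - s)],
      by linarith [min_le_right (-(s / q)) (1 - 1 / p - s)]⟩
  · exact .inr ⟨by linarith [le_max_left (1 / p) (1 - (s - s / q))],
      by linarith [le_max_right (1 / p) (1 - (s - s / q))], h₂⟩

/-- The three intervals of the recurrent set. -/
def threeIntervals (p q s d : ℝ) : Set ℝ :=
  Set.Icc (-s + d) (1 / p - (1 - 1 / q) * s - d) ∪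
    Set.Icc (min (-(s / q)) (1 - 1 / p - s) + d) (max (1 / p) (1 - (1 - 1 / q) * s) - d) ∪
    Set.Icc (1 - 1 / p - s / q + d) (1 - d)

lemma mem_interior_threeIntervals {p q s d x : ℝ} (h₁ : -s + d < x) (h₂ : x < 1 - d)
    (hx : x ∉ gapSet p q s d) : x ∈ interior (threeIntervals p q s d) := by
  have hsub : Set.Ioo (-s + d) (1 / p - (1 - 1 / q) * s - d) ∪
      Set.Ioo (min (-(s / q)) (1 - 1 / p - s) + d) (max (1 / p) (1 - (1 - 1 / q) * s) - d) ∪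
      Set.Ioo (1 - 1 / p - s / q + d) (1 - d) ⊆ interior (threeIntervals p q s d) :=
    interior_maximal
      (Set.union_subset_union (Set.union_subset_union Set.Ioo_subset_Icc_self
        Set.Ioo_subset_Icc_self) Set.Ioo_subset_Icc_self)
      ((isOpen_Ioo.union isOpen_Ioo).union isOpen_Ioo)
  apply hsub
  simp only [gapSet, Set.mem_union, Set.mem_Icc, not_or, not_and, not_le] at hx
  rcases lt_or_ge x (1 / p - (1 - 1 / q) * s - d) with h | h
  · exact .inl (.inl ⟨h₁, h⟩)
  rcases lt_or_ge x (max (1 / p) (1 - (1 - 1 / q) * s) - d) with h' | h'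
  · exact .inl (.inr ⟨hx.1 h, h'⟩)
  · exact .inr ⟨hx.2 h', h₂⟩

/-- The numerical constraints on the parameters used in the covering argument. -/
structure Admissible (p q s d : ℝ) : Prop where
  p_eq : p = 1.0321 ^ 40
  q_eq : q = 1.0321 ^ 31
  le_s : 1.1349 ≤ s
  s_le : s ≤ 1.1581
  d_pos : 0 < d
  d_le : d ≤ 1 / 10 ^ 6

namespace Admissible

variable {p q s d : ℝ}

lemma p_bounds (h : Admissible p q s d) : 3.53892 ≤ p ∧ p ≤ 3.53893 := by
  rw [h.p_eq]; norm_num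

lemma q_bounds (h : Admissible p q s d) : 2.66302 ≤ q ∧ q ≤ 2.66303 := by
  rw [h.q_eq]; norm_num

lemma inv_p_bounds (h : Admissible p q s d) : 0.28257 ≤ 1 / p ∧ 1 / p ≤ 0.28258 := by
  rw [h.p_eq]; norm_num

lemma div_q_bounds (h : Admissible p q s d) :
    0.37551 * s ≤ s / q ∧ s / q ≤ 0.37552 * s := by
  have hq := h.q_bounds
  have hs := h.le_s
  have hq0 : 0 < q := by linarith
  rw [le_div_iff₀ hq0, div_le_iff₀ hq0]
  constructor <;> nlinarith

lemma gap_bounds (h : Admissible p q s d) {g : ℝ} (hg : g ∈ gapSet p q s d) :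
    -0.441 < g ∧ g + s < 1.441 := by
  obtain ⟨hp, hp'⟩ := h.inv_p_bounds
  obtain ⟨hq, hq'⟩ := h.div_q_bounds
  have := h.le_s
  have := h.s_le
  have := h.d_le
  have := h.d_pos
  constructor <;> rcases of_mem_gapSet hg with ⟨h1, h2, h3⟩ | ⟨h1, h2, h3⟩ <;> linarith

lemma gap_sub_bounds (h : Admissible p q s d) {g g' : ℝ} (hg : g ∈ gapSet p q s d)
    (hg' : g' ∈ gapSet p q s d) :
    (-0.01 ≤ g' - g ∧ g' - g ≤ 0.01) ∨ 1 + s + (g' - g) ≤ 1.44 ∨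
      (2.82 ≤ 1 + s + (g' - g) ∧ 1 + s + (g' - g) ≤ 2.89) := by
  obtain ⟨hp, hp'⟩ := h.inv_p_bounds
  obtain ⟨hq, hq'⟩ := h.div_q_bounds
  have := h.le_s
  have := h.s_le
  have := h.d_le
  have := h.d_pos
  rcases of_mem_gapSet hg with ⟨h1, h2, h3⟩ | ⟨h1, h2, h3⟩ <;>
    rcases of_mem_gapSet hg' with ⟨h1', h2', h3'⟩ | ⟨h1', h2', h3'⟩
  · left; constructor <;> linarith
  · right; right; constructor <;> linarith
  · right; left; linarith
  · left; constructor <;> linarith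

lemma mergeable (h : Admissible p q s d) {o : ℝ} (h₁ : 1.45 ≤ o)
    (h₂ : o ≤ 2 ∨ (1 + s + 0.015 ≤ o ∧ o ≤ 2.8) ∨ 2.9 ≤ o) :
    MergeableOverlap (gapSet p q s d) s o := by
  refine ⟨by linarith, fun g hg => ?_, fun g hg => ?_, fun g hg g' hg' he => ?_⟩
  · linarith [(h.gap_bounds hg).1]
  · linarith [(h.gap_bounds hg).2]
  · have := h.le_s
    have := h.s_le
    rcases h.gap_sub_bounds hg hg' with ⟨h₃, h₄⟩ | h₃ | ⟨h₃, h₄⟩ <;>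
      rcases h₂ with h₂ | ⟨h₂, h₅⟩ | h₂ <;> linarith

lemma mergeable_of_large (h : Admissible p q s d) {o : ℝ} (ho : 2.9 ≤ o) :
    MergeableOverlap (gapSet p q s d) s o :=
  h.mergeable (by linarith) (.inr (.inr ho))

lemma covers_zero_one (h : Admissible p q s d) :
    CoversOffGaps (gapSet p q s d) s (digitCover p q s (threeIntervals p q s d) 0 1)
      (-(s * q ^ 1)) (p ^ 0) := by
  obtain ⟨hq, hq'⟩ := h.q_bounds
  have hs := h.le_s
  have hs' := h.s_le
  have hd := h.d_le
  have hsq : s * q ≤ 2.66303 * s := by nlinarith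
  have hsq' : 2.66302 * s ≤ s * q := by nlinarith
  intro x hA hB hxA hxB
  rw [pow_zero, sub_self, sub_zero] at hxB
  rw [pow_zero] at hB
  rw [pow_one] at hA hxA
  rcases lt_or_ge x (-s + 1 / 1000) with hx | hx
  · refine digitCover_succ_right (.inr rfl) (mem_digitCover_zero ?_)
    have e : x + 1 * (s * (q - 1) * q ^ 0) = x - (-(s * q) + s) := by ring
    rw [e]
    exact mem_interior_threeIntervals (by linarith) (by linarith) hxA
  · refine digitCover_succ_right (.inl rfl) (mem_digitCover_zero ?_)
    rw [zero_mul, add_zero]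
    exact mem_interior_threeIntervals (by linarith) (by linarith) hxB

lemma covers_five_six (h : Admissible p q s d) :
    CoversOffGaps (gapSet p q s d) s (digitCover p q s (threeIntervals p q s d) 5 6)
      (-(s * q ^ 6)) (p ^ 5) := by
  have hs := h.le_s
  have hs' := h.s_le
  have large_left (m n : ℕ) (hmn : 2.9 + (p - 2) * p ^ m ≤ 1.1349 * q ^ n) :
      MergeableOverlap (gapSet p q s d) s (s * q ^ n - (p - 2) * p ^ m) := by
    have : 0 < q ^ n := pow_pos (by linarith [h.q_bounds.1]) n
    exact h.mergeable_of_large (by nlinarith)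
  have large_right (m n : ℕ) (hmn : 1.1581 * (q - 2) * q ^ n + 2.9 ≤ p ^ m) :
      MergeableOverlap (gapSet p q s d) s (p ^ m - s * (q - 2) * q ^ n) := by
    have : 0 < (q - 2) * q ^ n :=
      mul_pos (by linarith [h.q_bounds.1]) (pow_pos (by linarith [h.q_bounds.1]) n)
    exact h.mergeable_of_large (by nlinarith)
  have h11 := h.covers_zero_one.succ_left (h.mergeable
    (by rw [h.p_eq, h.q_eq]; norm_num; linarith)
    (.inl (by rw [h.p_eq, h.q_eq]; norm_num; linarith)))
  have h12 := h11.succ_right (h.mergeable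
    (by rw [h.p_eq, h.q_eq]; norm_num; linarith)
    (.inl (by rw [h.p_eq, h.q_eq]; norm_num; linarith)))
  have h22 := h12.succ_left (h.mergeable (by rw [h.p_eq, h.q_eq]; norm_num; linarith)
    (.inr (.inl ⟨by rw [h.p_eq, h.q_eq]; norm_num; linarith,
      by rw [h.p_eq, h.q_eq]; norm_num; linarith⟩)))
  have h23 := h22.succ_right (large_right _ _ (by rw [h.p_eq, h.q_eq]; norm_num))
  have h33 := h23.succ_left (h.mergeable (by rw [h.p_eq, h.q_eq]; norm_num; linarith)
    (.inr (.inl ⟨by rw [h.p_eq, h.q_eq]; norm_num; linarith,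
      by rw [h.p_eq, h.q_eq]; norm_num; linarith⟩)))
  have h34 := h33.succ_right (large_right _ _ (by rw [h.p_eq, h.q_eq]; norm_num))
  have h35 := h34.succ_right (large_right _ _ (by rw [h.p_eq, h.q_eq]; norm_num))
  have h45 := h35.succ_left (large_left _ _ (by rw [h.p_eq, h.q_eq]; norm_num))
  have h46 := h45.succ_right (large_right _ _ (by rw [h.p_eq, h.q_eq]; norm_num))
  exact h46.succ_left (large_left _ _ (by rw [h.p_eq, h.q_eq]; norm_num))

lemma le_p_pow (h : Admissible p q s d) {m : ℕ} (hm : 5 ≤ m) : 500 ≤ p ^ m :=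
  calc (500 : ℝ) ≤ p ^ 5 := by rw [h.p_eq]; norm_num
    _ ≤ p ^ m := pow_le_pow_right₀ (by linarith [h.p_bounds.1]) hm

lemma mergeable_left (h : Admissible p q s d) {m n : ℕ} (hm : 5 ≤ m)
    (hmn : 40 * m + 10 ≤ 31 * n) :
    MergeableOverlap (gapSet p q s d) s (s * q ^ n - (p - 2) * p ^ m) := by
  have hpow : 1.0321 ^ 10 * p ^ m ≤ q ^ n := by
    rw [h.p_eq, h.q_eq, ← pow_mul, ← pow_mul, ← pow_add]
    exact pow_le_pow_right₀ (by norm_num) (by omega)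
  have hm' := h.le_p_pow hm
  have hs : (p - 2 + 0.01) * p ^ m ≤ s * q ^ n :=
    calc (p - 2 + 0.01) * p ^ m ≤ 1.1349 * (1.0321 ^ 10 * p ^ m) := by
          rw [← mul_assoc]
          refine mul_le_mul_of_nonneg_right ?_ (by linarith)
          rw [h.p_eq]; norm_num
      _ ≤ s * q ^ n := mul_le_mul h.le_s hpow (by positivity) (by linarith [h.le_s])
  exact h.mergeable_of_large (by linarith)

lemma mergeable_right (h : Admissible p q s d) {m n : ℕ} (hm : 5 ≤ m)
    (hmn : 31 * n ≤ 40 * m + 8) :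
    MergeableOverlap (gapSet p q s d) s (p ^ m - s * (q - 2) * q ^ n) := by
  have hpow : q ^ n ≤ 1.0321 ^ 8 * p ^ m := by
    rw [h.p_eq, h.q_eq, ← pow_mul, ← pow_mul, ← pow_add]
    exact pow_le_pow_right₀ (by norm_num) (by omega)
  have hm' := h.le_p_pow hm
  have hq := h.q_bounds
  have hs : s * (q - 2) * q ^ n ≤ 0.99 * p ^ m :=
    calc s * (q - 2) * q ^ n ≤ 1.1581 * 0.66303 * (1.0321 ^ 8 * p ^ m) := by
          refine mul_le_mul (mul_le_mul h.s_le ?_ ?_ ?_) hpow (pow_nonneg ?_ n) ?_ <;> linarith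
      _ ≤ 0.99 * p ^ m := by
          rw [← mul_assoc]
          exact mul_le_mul_of_nonneg_right (by norm_num) (by linarith)
  exact h.mergeable_of_large (by linarith)

/-- Along the lattice path `-31 < 31 n - 40 m < 40`, every digit cover is full off the gaps. -/
lemma covers_of_path (h : Admissible p q s d) (N : ℕ) : ∀ m n : ℕ, m + n = N → 5 ≤ m → m ≤ 30 →
    40 * m < 31 * n + 31 → 31 * n < 40 * m + 40 →
    CoversOffGaps (gapSet p q s d) s (digitCover p q s (threeIntervals p q s d) m n)
      (-(s * q ^ n)) (p ^ m) := by
  induction N with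
  | zero => intros; omega
  | succ N ih =>
    intro m n hN hm hm' hlo hhi
    rcases lt_trichotomy (31 * n) (40 * m) with hlt | heq | hgt
    · rcases hm.eq_or_lt with rfl | hm₅
      · obtain rfl : n = 6 := by omega
        exact h.covers_five_six
      · obtain ⟨m, rfl⟩ : ∃ k, m = k + 1 := ⟨m - 1, by omega⟩
        exact (ih m n (by omega) (by omega) (by omega) (by omega) (by omega)).succ_left
          (h.mergeable_left (by omega) (by omega))
    · omega
    · obtain ⟨n, rfl⟩ : ∃ k, n = k + 1 := ⟨n - 1, by omega⟩
      exact (ih m n (by omega) hm hm' (by omega) (by omega)).succ_right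
        (h.mergeable_right hm (by omega))

lemma brick_subset (h : Admissible p q s d) {x : ℝ} (h₁ : -(s * q ^ 39) + s * (q - 1) ≤ x)
    (h₂ : x ≤ p ^ 30 - s * (q - 1)) :
    x ∈ digitCover p q s (threeIntervals p q s d) 30 39 := by
  obtain ⟨hq, hq'⟩ := h.q_bounds
  have hs := h.le_s
  have hsq : 2.66302 * s ≤ s * q := by nlinarith
  refine h.covers_of_path 69 30 39 rfl (by norm_num) le_rfl (by norm_num) (by norm_num) x
    (by linarith) (by linarith) (fun hg => ?_) (fun hg => ?_)
  · linarith [(h.gap_bounds hg).2]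
  · linarith [(h.gap_bounds hg).1]

lemma pow_eq (h : Admissible p q s d) : p ^ 31 = q ^ 40 := by
  rw [h.p_eq, h.q_eq, ← pow_mul, ← pow_mul]

/-- A point of the trimmed first-level brick with digits `e`, `f` is covered. -/
lemma brick_covered (h : Admissible p q s d) (hd : d = (1 - 1 / q) * s / q ^ 39) {t e f : ℝ}
    (he : e = 0 ∨ e = 1) (hf : f = 0 ∨ f = 1)
    (h₁ : -(s / q) + d ≤ t - e * (1 - 1 / p) + f * ((1 - 1 / q) * s))
    (h₂ : t - e * (1 - 1 / p) + f * ((1 - 1 / q) * s) ≤ 1 / p - d) :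
    p ^ 31 * t ∈ digitCover p q s (threeIntervals p q s d) 31 40 := by
  have hp0 : 0 < p := by linarith [h.p_bounds.1]
  have hq0 : 0 < q := by linarith [h.q_bounds.1]
  have hpe : p ^ 31 * (1 / p) = p ^ 30 := by field_simp
  have hqe : p ^ 31 * (1 / q) = q ^ 39 := by rw [h.pow_eq]; field_simp
  have hde : p ^ 31 * d = s * (q - 1) := by
    rw [h.pow_eq, hd]; field_simp
  have hP : 0 < p ^ 31 := pow_pos hp0 _
  have hx : p ^ 31 * (t - e * (1 - 1 / p) + f * ((1 - 1 / q) * s))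
      = p ^ 31 * t + f * (s * (q - 1) * q ^ 39) - e * ((p - 1) * p ^ 30) := by
    linear_combination e * hpe - f * s * hqe + f * s * h.pow_eq
  refine digitCover_succ_right hf (digitCover_succ_left he ?_)
  rw [← hx]
  refine h.brick_subset ?_ ?_
  · have := mul_le_mul_of_nonneg_left h₁ hP.le
    linear_combination this + s * hqe - hde
  · have := mul_le_mul_of_nonneg_left h₂ hP.le
    linear_combination this + hpe - hde

lemma recurrent (h : Admissible p q s d) (hd : d = (1 - 1 / q) * s / q ^ 39) {t : ℝ}
    (ht : t ∈ threeIntervals p q s d) :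
    p ^ 31 * t ∈ digitCover p q s (threeIntervals p q s d) 31 40 := by
  obtain ⟨hp, hp'⟩ := h.inv_p_bounds
  obtain ⟨hq, hq'⟩ := h.div_q_bounds
  have e : (1 - 1 / q) * s = s - s / q := by ring
  have := h.le_s
  have := h.s_le
  have := h.d_le
  have := h.d_pos
  rw [threeIntervals, e] at ht
  rcases ht with (⟨h₁, h₂⟩ | ⟨h₁, h₂⟩) | ⟨h₁, h₂⟩
  · exact h.brick_covered hd (.inl rfl) (.inr rfl) (by linarith) (by linarith)
  · have h00 (h₁ : -(s / q) + d ≤ t) (h₂ : t ≤ 1 / p - d) :=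
      h.brick_covered hd (t := t) (.inl rfl) (.inl rfl) (by linarith) (by linarith)
    have h11 (h₁ : 1 - 1 / p - s + d ≤ t) (h₂ : t ≤ 1 - (s - s / q) - d) :=
      h.brick_covered hd (t := t) (.inr rfl) (.inr rfl) (by linarith) (by linarith)
    rcases le_total (s - s / q) (1 - 1 / p) with hc | hc
    · rw [min_eq_left (by linarith)] at h₁
      rw [max_eq_right (by linarith)] at h₂
      rcases le_total t (1 / p - d) with h' | h'
      · exact h00 h₁ h'
      · exact h11 (by linarith) h₂
    · rw [min_eq_right (by linarith)] at h₁
      rw [max_eq_left (by linarith)] at h₂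
      rcases le_total t (-(s / q) + d) with h' | h'
      · exact h11 h₁ (by linarith)
      · exact h00 h' h₂
  · exact h.brick_covered hd (.inr rfl) (.inl rfl) (by linarith) (by linarith)

/-- Covered points are returned to the interior by some return map. -/
lemma exists_return (h : Admissible p q s d) {I : Set ℝ} {t : ℝ}
    (ht : p ^ 31 * t ∈ digitCover p q s I 31 40) :
    ∃ a b : ℕ → ℝ, (∀ k, a k = 0 ∨ a k = 1) ∧ (∀ k, b k = 0 ∨ b k = 1) ∧
      p ^ 31 * t - (p - 1) * p ^ 30 * (∑ k ∈ Finset.range 31, a k / p ^ k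
        - p * (q - 1) / (q * (p - 1)) * s * ∑ k ∈ Finset.range 40, b k / q ^ k) ∈ interior I := by
  obtain ⟨a, b, ha, hb, hab⟩ := ht
  refine ⟨fun k => a (30 - k), fun k => b (39 - k), fun k => ha _, fun k => hb _, ?_⟩
  have hp0 : p ≠ 0 := by linarith [h.p_bounds.1]
  have hq0 : q ≠ 0 := by linarith [h.q_bounds.1]
  have hp1 : p - 1 ≠ 0 := by linarith [h.p_bounds.1]
  have hc : (p - 1) * p ^ 30 * (p * (q - 1) / (q * (p - 1)) * s) = s * (q - 1) * q ^ 39 := by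
    field_simp
    linear_combination s * (q - 1) * h.pow_eq
  convert hab using 1
  rw [← pow_mul_sum_reflect hp0 a 30, ← pow_mul_sum_reflect hq0 b 39]
  linear_combination (∑ k ∈ Finset.range 40, b (39 - k) / q ^ k) * hc

end Admissible

/-- Lemma 1 of the paper. With `γ = 1.0321`, `p = γ^40`, `q = γ^31`,
`s₁, s₂` as in the paper and `s* = (p(q-1)/(q(p-1))) s`, the set
`I_s^- = [a₁,b₁] ∪ [a₂⁻,b₂⁻] ∪ [a₃,b₃]` is recurrent for the family of return maps
`t ↦ p^31 t - (p-1)p^30 (∑_{k≤30} a_k/p^k - s* ∑_{k≤39} b_k/q^k)` whenever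
`s₁ ≤ s ≤ q(p-1)/(p(q-1))`, and `I_s^+ = [a₁,b₁] ∪ [a₂⁺,b₂⁺] ∪ [a₃,b₃]` is recurrent
for this family whenever `q(p-1)/(p(q-1)) < s ≤ s₂`: every point of the set is sent
into its interior by some member of the family. -/
theorem Is_recurrent :
    let γ : ℝ := 1.0321
    let p : ℝ := γ ^ 40
    let q : ℝ := γ ^ 31
    let s₁ : ℝ := (1 / p) / (1 - 2 / q + 2 * (1 - 1 / q) / q ^ 39)
    let s₂ : ℝ := (1 - 2 / p) / (1 / q - 2 * (1 - 1 / q) / q ^ 39)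
    ∀ s : ℝ,
      let sstar : ℝ := p * (q - 1) / (q * (p - 1)) * s
      let a₁ : ℝ := -(q * (p - 1) / (p * (q - 1))) * sstar + (1 - 1 / p) * sstar / q ^ 39
      let b₁ : ℝ := 1 / p - (1 - 1 / p) * (1 + 1 / q ^ 39) * sstar
      let a₂m : ℝ := -((p - 1) / (p * (q - 1))) * sstar + (1 - 1 / p) * sstar / q ^ 39
      let b₂m : ℝ := 1 - (1 - 1 / p) * (1 + 1 / q ^ 39) * sstar
      let a₂p : ℝ := 1 - 1 / p - q * (p - 1) / (p * (q - 1)) * sstar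
        + (1 - 1 / p) * sstar / q ^ 39
      let b₂p : ℝ := 1 / p - (1 - 1 / p) * sstar / q ^ 39
      let a₃ : ℝ := 1 - 1 / p - (p - 1) / (p * (q - 1)) * sstar
        + (1 - 1 / p) * sstar / q ^ 39
      let b₃ : ℝ := 1 - (1 - 1 / p) * sstar / q ^ 39
      let Im : Set ℝ := Set.Icc a₁ b₁ ∪ Set.Icc a₂m b₂m ∪ Set.Icc a₃ b₃
      let Ip : Set ℝ := Set.Icc a₁ b₁ ∪ Set.Icc a₂p b₂p ∪ Set.Icc a₃ b₃
      (s₁ ≤ s → s ≤ q * (p - 1) / (p * (q - 1)) →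
        ∀ t ∈ Im, ∃ a b : ℕ → ℝ,
          (∀ k, a k = 0 ∨ a k = 1) ∧ (∀ k, b k = 0 ∨ b k = 1) ∧
          p ^ 31 * t - (p - 1) * p ^ 30 *
              (∑ k ∈ Finset.range 31, a k / p ^ k
                - sstar * ∑ k ∈ Finset.range 40, b k / q ^ k) ∈ interior Im) ∧
      (q * (p - 1) / (p * (q - 1)) < s → s ≤ s₂ →
        ∀ t ∈ Ip, ∃ a b : ℕ → ℝ,
          (∀ k, a k = 0 ∨ a k = 1) ∧ (∀ k, b k = 0 ∨ b k = 1) ∧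
          p ^ 31 * t - (p - 1) * p ^ 30 *
              (∑ k ∈ Finset.range 31, a k / p ^ k
                - sstar * ∑ k ∈ Finset.range 40, b k / q ^ k) ∈ interior Ip) := by
  intro γ p q s₁ s₂ s sstar a₁ b₁ a₂m b₂m a₂p b₂p a₃ b₃ Im Ip
  have hp : 3 ≤ p := by norm_num [p, γ]
  have hq : 2 ≤ q := by norm_num [q, γ]
  obtain ⟨hP, hP'⟩ : 0.28257 ≤ 1 / p ∧ 1 / p ≤ 0.28258 := by norm_num [p, γ]
  obtain ⟨hQ, hQ'⟩ : 0.37551 ≤ 1 / q ∧ 1 / q ≤ 0.37552 := by norm_num [q, γ]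
  have hpe : p = 1.0321 ^ 40 := rfl
  have hqe : q = 1.0321 ^ 31 := rfl
  clear_value p q
  have hp0 : p ≠ 0 := by linarith
  have hq0 : q ≠ 0 := by linarith
  have hp1 : p - 1 ≠ 0 := by linarith
  have hq1 : q - 1 ≠ 0 := by linarith
  have hpow : (10 : ℝ) ^ 7 ≤ q ^ 39 :=
    calc (10 : ℝ) ^ 7 ≤ 2 ^ 39 := by norm_num
      _ ≤ q ^ 39 := pow_le_pow_left₀ (by norm_num) (by linarith) 39
  have hpos : 0 < q ^ 39 := by linarith
  obtain ⟨hε, hε'⟩ : 0 < 2 * (1 - 1 / q) / q ^ 39 ∧ 2 * (1 - 1 / q) / q ^ 39 ≤ 1 / 10 ^ 6 := by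
    refine ⟨div_pos (by linarith) hpos, ?_⟩
    rw [div_le_iff₀ hpos]
    linarith
  have hmid : q * (p - 1) / (p * (q - 1)) = (1 - 1 / p) / (1 - 1 / q) := by
    rw [div_eq_div_iff (by positivity) (by linarith)]
    field_simp
  have hmid₁ : 1.148 ≤ q * (p - 1) / (p * (q - 1)) := by
    rw [hmid, le_div_iff₀ (by linarith)]
    linarith
  have hmid₂ : q * (p - 1) / (p * (q - 1)) ≤ 1.15 := by
    rw [hmid, div_le_iff₀ (by linarith)]
    linarith
  have hs₁ : 1.1349 ≤ s₁ := by
    simp only [s₁]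
    rw [le_div_iff₀ (by linarith [show 2 / q = 2 * (1 / q) by ring])]
    linarith [show 2 / q = 2 * (1 / q) by ring]
  have hs₂ : s₂ ≤ 1.1581 := by
    simp only [s₂]
    rw [div_le_iff₀ (by linarith)]
    linarith [show 2 / p = 2 * (1 / p) by ring]
  clear_value s₁ s₂
  obtain ⟨d, hd⟩ : ∃ d, d = (1 - 1 / q) * s / q ^ 39 := ⟨_, rfl⟩
  have hds : (1 - 1 / p) * sstar = (1 - 1 / q) * s := by
    simp only [sstar]
    field_simp
  have hd' : (1 - 1 / p) * sstar / q ^ 39 = d := by rw [hds, hd]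
  have hs' : q * (p - 1) / (p * (q - 1)) * sstar = s := by
    simp only [sstar]
    field_simp
  have hsq : (p - 1) / (p * (q - 1)) * sstar = s / q := by
    simp only [sstar]
    field_simp
  have ha₁ : a₁ = -s + d := by simp only [a₁]; rw [hd', neg_mul, hs']
  have hb₁ : b₁ = 1 / p - (1 - 1 / q) * s - d := by
    simp only [b₁]; rw [← hd', ← hds]; ring
  have ha₂m : a₂m = -(s / q) + d := by simp only [a₂m]; rw [hd', neg_mul, hsq]
  have hb₂m : b₂m = 1 - (1 - 1 / q) * s - d := by
    simp only [b₂m]; rw [← hd', ← hds]; ring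
  have ha₂p : a₂p = 1 - 1 / p - s + d := by simp only [a₂p]; rw [hd', hs']
  have hb₂p : b₂p = 1 / p - d := by simp only [b₂p]; rw [hd']
  have ha₃ : a₃ = 1 - 1 / p - s / q + d := by simp only [a₃]; rw [hd', hsq]
  have hb₃ : b₃ = 1 - d := by simp only [b₃]; rw [hd']
  have e : (1 - 1 / q) * s = s - s / q := by ring
  have hadm (h₁ : 1.1349 ≤ s) (h₂ : s ≤ 1.1581) : Admissible p q s d := by
    refine ⟨hpe, hqe, h₁, h₂, ?_, ?_⟩
    · rw [hd]
      exact div_pos (mul_pos (by linarith) (by linarith)) hpos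
    · rw [hd, div_le_iff₀ hpos]
      nlinarith
  refine ⟨fun hlo hhi t ht => ?_, fun hlo hhi t ht => ?_⟩
  · have h := hadm (by linarith) (by linarith)
    rw [hmid, le_div_iff₀ (by linarith)] at hhi
    have hI : Im = threeIntervals p q s d := by
      simp only [Im, threeIntervals]
      rw [min_eq_left (by linarith), max_eq_right (by linarith), ha₁, hb₁, ha₂m, hb₂m, ha₃, hb₃]
    rw [hI] at ht ⊢
    exact h.exists_return (h.recurrent hd ht)
  · have h := hadm (by linarith) (by linarith)
    rw [hmid, div_lt_iff₀ (by linarith)] at hlo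
    have hI : Ip = threeIntervals p q s d := by
      simp only [Ip, threeIntervals]
      rw [min_eq_right (by linarith), max_eq_left (by linarith), ha₁, hb₁, ha₂p, hb₂p, ha₃, hb₃]
    rw [hI] at ht ⊢
    exact h.exists_return (h.recurrent hd ht)
end

section
/- Let γ := 1.0321, p := γ^{40}, q := γ^{31}, s₁ := (1/p)/(1 − 2/q + 2(1−1/q)/q^{39}), s₂ := (1 − 2/p)/(1/q − 2(1−1/q)/q^{39}). Define the four operators on (ℝ\{0}) × ℝ: T₀(s,t) = (p s, p t), T₁(s,t) = (p s, p t − p + 1), T₀'(s,t) = (s/q, t), T₁'(s,t) = (s/q, t + ((q−1)/q)s). Define Δ := {(s,t) : γ^{−1}s₂ ≤ s ≤ γ s₁ and −s + (1−1/q)s/q^{39} ≤ t ≤ 1 − (1−1/q)s/q^{39}}, Δ₁ := {(s,t) : t + (1−1/q)(1+1/q^{39})s > 1 and t + (1−1/q)s/q^{39} > 1/p and t + (1/q − (1−1/q)/q^{39})s < 1 − 1/p}, Δ₂ := {(s,t) : t + (1 − (1−1/q)/q^{39})s < 1 − 1/p and t + (1/q − (1−1/q)/q^{39})s < 0 and t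 + (1−1/q)(1+1/q^{39})s > 1/p}, and ℒ := Δ \ (Δ₁ ∪ Δ₂). Then ℒ is a recurrent compact set for these operators: ℒ is compact, and for every (s,t) ∈ ℒ there exist n ≥ 1 and maps f₁, …, f_n, each belonging to {T₀, T₁, T₀', T₁'}, such that (f_n ∘ ⋯ ∘ f₁)(s,t) lies in the topological interior of ℒ. -/
/-! ### Words in the four operators -/

/-- The four transferred renormalization operators. -/
def renormOps (p q : ℝ) : Set (ℝ × ℝ → ℝ × ℝ) :=
  {fun st => (p * st.1, p * st.2), fun st => (p * st.1, p * st.2 - p + 1),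
    fun st => (st.1 / q, st.2), fun st => (st.1 / q, st.2 + (q - 1) / q * st.1)}

/-- Some word made of `n` operators sends `x` into `U`. -/
def HitsIn (p q : ℝ) (U : Set (ℝ × ℝ)) (n : ℕ) (x : ℝ × ℝ) : Prop :=
  ∃ l : List (ℝ × ℝ → ℝ × ℝ), l.length = n ∧ (∀ g ∈ l, g ∈ renormOps p q) ∧
    l.foldl (fun y g => g y) x ∈ U

lemma HitsIn.cons {p q : ℝ} {U : Set (ℝ × ℝ)} {n : ℕ} {x : ℝ × ℝ} {g : ℝ × ℝ → ℝ × ℝ}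
    (hg : g ∈ renormOps p q) (h : HitsIn p q U n (g x)) : HitsIn p q U (n + 1) x := by
  obtain ⟨l, hl, hmem, hU⟩ := h
  refine ⟨g :: l, by simp [hl], ?_, by simpa using hU⟩
  intro f hf
  rcases List.mem_cons.1 hf with rfl | hf
  exacts [hg, hmem f hf]

lemma HitsIn.trans {p q : ℝ} {U V : Set (ℝ × ℝ)} {m n : ℕ} {x : ℝ × ℝ}
    (h : HitsIn p q U m x) (hU : ∀ y ∈ U, HitsIn p q V n y) : HitsIn p q V (m + n) x := by
  obtain ⟨l, hl, hmem, hx⟩ := h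
  obtain ⟨l', hl', hmem', hy⟩ := hU _ hx
  refine ⟨l ++ l', by simp [hl, hl'], ?_, by simpa using hy⟩
  intro f hf
  rcases List.mem_append.1 hf with hf | hf
  exacts [hmem f hf, hmem' f hf]

lemma HitsIn.mono {p q : ℝ} {U V : Set (ℝ × ℝ)} {n : ℕ} {x : ℝ × ℝ}
    (h : HitsIn p q U n x) (hUV : U ⊆ V) : HitsIn p q V n x := by
  obtain ⟨l, hl, hmem, hx⟩ := h
  exact ⟨l, hl, hmem, hUV hx⟩

/-- A family of predicates on `r`, indexed by the numbers of operators of each kind still to be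
applied, that is closed under going one step backwards. Here `r` is the overlap of the two hulls
measured from the right end of the first one, in the units of the final scale. -/
structure BackwardClosed (p q s : ℝ) (W : ℕ → ℕ → ℝ → Prop) : Prop where
  keep : ∀ a b r, W a b r → W (a + 1) b r
  shift : ∀ a b r, W a b (r - (p - 1) * p ^ a) → W (a + 1) b r
  keep' : ∀ a b r, W a b r → W a (b + 1) r
  shift' : ∀ a b r, W a b (r - (q - 1) * (s * q ^ b)) → W a (b + 1) r

lemma backwardClosed_hitsIn {p q : ℝ} (s : ℝ) (hp : 0 < p) (hq : 0 < q) (U : Set (ℝ × ℝ)) :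
    BackwardClosed p q s fun a b r =>
      HitsIn p q U (a + b) (s * q ^ b / p ^ a, 1 - r / p ^ a) where
  keep a b r h := by
    rw [show a + 1 + b = a + b + 1 by ring]
    refine HitsIn.cons (g := fun st => (p * st.1, p * st.2 - p + 1)) (by simp [renormOps]) ?_
    convert h using 1
    refine Prod.ext ?_ ?_ <;> dsimp only <;> field_simp <;> ring
  shift a b r h := by
    rw [show a + 1 + b = a + b + 1 by ring]
    refine HitsIn.cons (g := fun st => (p * st.1, p * st.2)) (by simp [renormOps]) ?_
    convert h using 1
    refine Prod.ext ?_ ?_ <;> dsimp only <;> field_simp <;> ring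
  keep' a b r h := by
    rw [← add_assoc]
    refine HitsIn.cons (g := fun st => (st.1 / q, st.2)) (by simp [renormOps]) ?_
    convert h using 1
    refine Prod.ext ?_ rfl
    dsimp only
    field_simp
    ring
  shift' a b r h := by
    rw [← add_assoc]
    refine HitsIn.cons (g := fun st => (st.1 / q, st.2 + (q - 1) / q * st.1))
      (by simp [renormOps]) ?_
    convert h using 1
    refine Prod.ext ?_ ?_ <;> dsimp only <;> field_simp <;> ring

/-! ### Linked hulls stay linked -/

/-- `W a b` contains every configuration whose hulls overlap by at least `D`. -/
def Linked (p q s D : ℝ) (W : ℕ → ℕ → ℝ → Prop) (a b : ℕ) : Prop :=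
  ∀ r, D ≤ r → r ≤ p ^ a + s * q ^ b - D → W a b r

lemma Linked.succ_left {p q s D : ℝ} {W : ℕ → ℕ → ℝ → Prop} (hW : BackwardClosed p q s W)
    {a b : ℕ} (h : Linked p q s D W a b) (hD : 2 * D ≤ s * q ^ b - (p - 2) * p ^ a) :
    Linked p q s D W (a + 1) b := by
  intro r h1 h2
  rw [pow_succ] at h2
  by_cases hr : r ≤ p ^ a + s * q ^ b - D
  · exact hW.keep _ _ _ (h r h1 hr)
  · push Not at hr
    exact hW.shift _ _ _ (h _ (by linarith) (by linarith))

lemma Linked.succ_right {p q s D : ℝ} {W : ℕ → ℕ → ℝ → Prop} (hW : BackwardClosed p q s W)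
    {a b : ℕ} (h : Linked p q s D W a b) (hD : 2 * D ≤ p ^ a - (q - 2) * (s * q ^ b)) :
    Linked p q s D W a (b + 1) := by
  intro r h1 h2
  rw [pow_succ] at h2
  by_cases hr : r ≤ p ^ a + s * q ^ b - D
  · exact hW.keep' _ _ _ (h r h1 hr)
  · push Not at hr
    exact hW.shift' _ _ _ (h _ (by linarith) (by linarith))

/-- Induction along the path in `ℕ × ℕ` on which `31 * b - 40 * a` stays in `[-30, 39]`. -/
lemma induction_along_path {P : ℕ → ℕ → Prop} {a₀ b₀ N : ℕ} (hN : N ≤ 69)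
    (hwin : -30 ≤ 31 * (b₀ : ℤ) - 40 * a₀ ∧ 31 * (b₀ : ℤ) - 40 * a₀ ≤ 39)
    (h0 : P a₀ b₀)
    (hleft : ∀ a b : ℕ, a₀ + b₀ ≤ a + b → a + b < N → 10 ≤ 31 * (b : ℤ) - 40 * a →
      31 * (b : ℤ) - 40 * a ≤ 39 → P a b → P (a + 1) b)
    (hright : ∀ a b : ℕ, a₀ + b₀ ≤ a + b → a + b < N → -30 ≤ 31 * (b : ℤ) - 40 * a →
      31 * (b : ℤ) - 40 * a ≤ 8 → P a b → P a (b + 1)) :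
    ∀ a b : ℕ, a₀ + b₀ ≤ a + b → a + b ≤ N → -30 ≤ 31 * (b : ℤ) - 40 * a →
      31 * (b : ℤ) - 40 * a ≤ 39 → P a b := by
  suffices H : ∀ n a b : ℕ, a + b = a₀ + b₀ + n → a + b ≤ N → -30 ≤ 31 * (b : ℤ) - 40 * a →
      31 * (b : ℤ) - 40 * a ≤ 39 → P a b from
    fun a b h => H (a + b - (a₀ + b₀)) a b (by omega)
  intro n
  induction n with
  | zero =>
    intro a b h _ h1 h2
    obtain rfl : a = a₀ := by omega
    obtain rfl : b = b₀ := by omega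
    exact h0
  | succ n ih =>
    intro a b h hab h1 h2
    rcases lt_trichotomy (31 * (b : ℤ) - 40 * a) 0 with hj | hj | hj
    · obtain ⟨a, rfl⟩ : ∃ a', a = a' + 1 := ⟨a - 1, by omega⟩
      push_cast at *
      exact hleft a b (by omega) (by omega) (by omega) (by omega)
        (ih a b (by omega) (by omega) (by omega) (by omega))
    · omega
    · obtain ⟨b, rfl⟩ : ∃ b', b = b' + 1 := ⟨b - 1, by omega⟩
      push_cast at *
      exact hright a b (by omega) (by omega) (by omega) (by omega)
        (ih a b (by omega) (by omega) (by omega) (by omega))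

lemma pow_le_pow_mul_of_exponent {γ : ℝ} (hγ : 1 ≤ γ) {a b j : ℕ}
    (h : 31 * (b : ℤ) - 40 * a ≤ j) : (γ ^ 31) ^ b ≤ γ ^ j * (γ ^ 40) ^ a := by
  rw [← pow_mul, ← pow_mul, ← pow_add]
  exact pow_le_pow_right₀ hγ (by omega)

lemma pow_mul_le_pow_of_exponent {γ : ℝ} (hγ : 1 ≤ γ) {a b j : ℕ}
    (h : (j : ℤ) ≤ 31 * (b : ℤ) - 40 * a) : γ ^ j * (γ ^ 40) ^ a ≤ (γ ^ 31) ^ b := by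
  rw [← pow_mul, ← pow_mul, ← pow_add]
  exact pow_le_pow_right₀ hγ (by omega)

/-- If the scale stays away from the critical ones along the path, linked hulls stay linked. -/
lemma linked_along_path {γ s D A c d : ℝ} {W : ℕ → ℕ → ℝ → Prop} {a₀ b₀ N i j : ℕ}
    (hγ : 1 ≤ γ) (hq : 2 ≤ γ ^ 31) (hs : 0 ≤ s)
    (hW : BackwardClosed (γ ^ 40) (γ ^ 31) s W) (hN : N ≤ 69)
    (hwin : -30 ≤ 31 * (b₀ : ℤ) - 40 * a₀ ∧ 31 * (b₀ : ℤ) - 40 * a₀ ≤ 39)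
    (h0 : Linked (γ ^ 40) (γ ^ 31) s D W a₀ b₀)
    (hi : ∀ a b : ℕ, a₀ + b₀ ≤ a + b → a + b < N → 10 ≤ 31 * (b : ℤ) - 40 * a →
      31 * (b : ℤ) - 40 * a ≤ 39 → (i : ℤ) ≤ 31 * (b : ℤ) - 40 * a)
    (hj : ∀ a b : ℕ, a₀ + b₀ ≤ a + b → a + b < N → -30 ≤ 31 * (b : ℤ) - 40 * a →
      31 * (b : ℤ) - 40 * a ≤ 8 → 31 * (b : ℤ) - 40 * a ≤ (j : ℤ))
    (hA : ∀ a b : ℕ, a₀ + b₀ ≤ a + b → -30 ≤ 31 * (b : ℤ) - 40 * a →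
      31 * (b : ℤ) - 40 * a ≤ 39 → A ≤ (γ ^ 40) ^ a)
    (hc : 0 ≤ c) (hcs : c ≤ s * γ ^ i - (γ ^ 40 - 2)) (hcD : 2 * D ≤ c * A)
    (hd : 0 ≤ d) (hds : d ≤ 1 - (γ ^ 31 - 2) * (s * γ ^ j)) (hdD : 2 * D ≤ d * A) :
    ∀ a b : ℕ, a₀ + b₀ ≤ a + b → a + b ≤ N → -30 ≤ 31 * (b : ℤ) - 40 * a →
      31 * (b : ℤ) - 40 * a ≤ 39 → Linked (γ ^ 40) (γ ^ 31) s D W a b := by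
  refine induction_along_path hN hwin h0 ?_ ?_
  · intro a b h1 h2 h3 h4 h
    refine h.succ_left hW ?_
    have hpa : A ≤ (γ ^ 40) ^ a := hA a b h1 (by omega) h4
    have hpos : 0 ≤ (γ ^ 40) ^ a := by positivity
    have hpow := mul_le_mul_of_nonneg_left (pow_mul_le_pow_of_exponent hγ (hi a b h1 h2 h3 h4)) hs
    have e1 := mul_le_mul_of_nonneg_right hcs hpos
    have e2 := mul_le_mul_of_nonneg_left hpa hc
    linarith
  · intro a b h1 h2 h3 h4 h
    refine h.succ_right hW ?_
    have hpa : A ≤ (γ ^ 40) ^ a := hA a b h1 h3 (by omega)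
    have hpos : 0 ≤ (γ ^ 40) ^ a := by positivity
    have hpow := mul_le_mul_of_nonneg_left (mul_le_mul_of_nonneg_left
      (pow_le_pow_mul_of_exponent hγ (hj a b h1 h2 h3 h4)) hs) (sub_nonneg.2 hq)
    have e1 := mul_le_mul_of_nonneg_right hds hpos
    have e2 := mul_le_mul_of_nonneg_left hpa hd
    linarith

/-! ### Filling the holes -/

/-- `x` avoids the hole `[α, β]` and its mirror image in `[0, m]`. -/
def AvoidsHoles (α β m x : ℝ) : Prop := (x < α ∨ β < x) ∧ (x < m - β ∨ m - α < x)

lemma AvoidsHoles.of_lt {α β m x : ℝ} (hβ : β ≤ m - α) (h : m - α < x) :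
    AvoidsHoles α β m x := ⟨Or.inr (hβ.trans_lt h), Or.inr h⟩

lemma avoidsHoles_sub {α β m x : ℝ} : AvoidsHoles α β m (m - x) ↔ AvoidsHoles α β m x := by
  unfold AvoidsHoles
  constructor <;> rintro ⟨h1 | h1, h2 | h2⟩ <;> constructor <;>
    first
      | (left; linarith)
      | (right; linarith)

/-- Every `r` in `[η, R - η]` at which neither end sees a hole satisfies `W`. -/
def HolesAtEnds (α β m η R : ℝ) (W : ℝ → Prop) : Prop :=
  ∀ r, η ≤ r → r ≤ R - η → AvoidsHoles α β m r → AvoidsHoles α β m (R - r) → W r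

/-- Two translates of an interval with holes near its ends fill each other's holes in the overlap
as long as the length of the overlap is not a sum of two hole positions. -/
lemma HolesAtEnds.union {α β m η R σ : ℝ} {W V : ℝ → Prop} (h : HolesAtEnds α β m η R W)
    (hV : ∀ r, W r → V r) (hV' : ∀ r, W (r - σ) → V r)
    (hαβ : α ≤ β) (hβ : β ≤ m - β) (hη : η ≤ m - α)
    (hl : m - α + η < R - σ)
    (hsum : (2 * β < R - σ ∧ R - σ < m - (β - α)) ∨
      (m + (β - α) < R - σ ∧ R - σ < 2 * m - 2 * β) ∨ 2 * m - 2 * α < R - σ) :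
    HolesAtEnds α β m η (R + σ) V := by
  intro r h1 h2 h3 h4
  by_cases hr : r ≤ R - η
  · by_cases hH : AvoidsHoles α β m (R - r)
    · exact hV r (h r h1 hr h3 hH)
    · have hH' : (α ≤ R - r ∧ R - r ≤ β) ∨ (m - β ≤ R - r ∧ R - r ≤ m - α) := by
        unfold AvoidsHoles at hH
        by_contra hcon
        push Not at hcon
        refine hH ⟨?_, ?_⟩
        · exact (lt_or_ge _ _).imp_right hcon.1
        · exact (lt_or_ge _ _).imp_right hcon.2
      have hle : R - r ≤ m - α := by rcases hH' with h | h <;> linarith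
      refine hV' r (h _ (by linarith) (by linarith) ?_ (by convert h4 using 1; ring))
      rcases hH' with ⟨k1, k2⟩ | ⟨k1, k2⟩ <;> rcases hsum with ⟨l1, l2⟩ | ⟨l1, l2⟩ | l1 <;>
        constructor <;>
        first
          | (left; linarith)
          | (right; linarith)
  · push Not at hr
    exact hV' r (h _ (by linarith) (by linarith) (.of_lt (by linarith) (by linarith))
      (by convert h4 using 1; ring))

/-- One step backwards in both directions moves the holes to the ends. -/
lemma holesAtEnds_one_one {p q s α β : ℝ} {W : ℕ → ℕ → ℝ → Prop}
    (hW : BackwardClosed p q s W)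
    (hp : 3.53892 ≤ p) (hp' : p ≤ 3.53893) (hq : 2.66302 ≤ q) (hq' : q ≤ 2.66303)
    (hs : 1.1349 ≤ s) (hs' : s ≤ 1.1581)
    (hα : 0.708 ≤ α) (hβ : β ≤ 0.7176)
    (h0 : ∀ x, 0.001 ≤ x → x ≤ 1 + s - 0.001 → AvoidsHoles α β (1 + s) x → W 0 0 x) :
    HolesAtEnds α β (1 + s) 0.001 (p ^ 1 + s * q ^ 1) (W 1 1) := by
  intro r h1 h2 h3 h4
  rw [pow_one, pow_one] at h2 h4
  have hsq : 2.66302 * s ≤ s * q := by nlinarith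
  have hsq' : s * q ≤ 2.66303 * s := by nlinarith
  have k00 : W 0 0 r → W 1 1 r := fun h => hW.keep' _ _ _ (hW.keep _ _ _ h)
  have k10 : W 0 0 (r - (p - 1)) → W 1 1 r := fun h =>
    hW.keep' _ _ _ (hW.shift _ _ _ (by simpa using h))
  have k01 : W 0 0 (r - (q - 1) * s) → W 1 1 r := fun h =>
    hW.shift' _ _ _ (hW.keep _ _ _ (by simpa using h))
  have k11 : W 0 0 (r - (q - 1) * s - (p - 1)) → W 1 1 r := fun h =>
    hW.shift' _ _ _ (hW.shift _ _ _ (by simpa using h))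
  rcases le_total r 2.1 with c1 | c1
  · exact k00 (h0 _ h1 (by linarith) h3)
  rcases le_total r 2.59 with c2 | c2
  · exact k01 (h0 _ (by linarith) (by linarith) ⟨by left; linarith, by left; linarith⟩)
  rcases le_total r 3.24 with c3 | c3
  · exact k10 (h0 _ (by linarith) (by linarith) ⟨by left; linarith, by left; linarith⟩)
  rcases le_total r 3.28 with c4 | c4
  · exact k01 (h0 _ (by linarith) (by linarith) ⟨by right; linarith, by left; linarith⟩)
  rcases le_total r 3.94 with c5 | c5
  · exact k10 (h0 _ (by linarith) (by linarith) ⟨by right; linarith, by left; linarith⟩)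
  rcases le_total r 4.01 with c6 | c6
  · exact k01 (h0 _ (by linarith) (by linarith) ⟨by right; linarith, by right; linarith⟩)
  rcases le_total r 4.6 with c7 | c7
  · exact k10 (h0 _ (by linarith) (by linarith) ⟨by right; linarith, by right; linarith⟩)
  · refine k11 (h0 _ (by linarith) (by linarith) (avoidsHoles_sub.1 ?_))
    convert h4 using 1
    ring

/-- If the final configurations are missing only the holes, then going back five steps of the first
kind and six of the second fills all of them, up to the ends. -/
lemma linked_five_six_of_holes {p q s α β : ℝ} {W : ℕ → ℕ → ℝ → Prop}
    (hW : BackwardClosed p q s W)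
    (hp : 3.53892 ≤ p) (hp' : p ≤ 3.53893) (hq : 2.66302 ≤ q) (hq' : q ≤ 2.66303)
    (hs : 1.1349 ≤ s) (hs' : s ≤ 1.1581)
    (hα : 0.708 ≤ α) (hαβ : α ≤ β) (hβ : β ≤ 0.7176)
    (h0 : ∀ x, 0.001 ≤ x → x ≤ 1 + s - 0.001 → AvoidsHoles α β (1 + s) x → W 0 0 x) :
    Linked p q s ((q - 1) * s) W 5 6 := by
  have h11 := holesAtEnds_one_one hW hp hp' hq hq' hs hs' hα hβ h0
  have hs0 : 0 ≤ s := by linarith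
  have pw : ∀ {x l u : ℝ} (n : ℕ), 0 ≤ l → l ≤ x → x ≤ u → l ^ n ≤ x ^ n ∧ x ^ n ≤ u ^ n :=
    fun n h0 h1 h2 => ⟨pow_le_pow_left₀ h0 h1 n, pow_le_pow_left₀ (h0.trans h1) h2 n⟩
  have sb : ∀ {x l u : ℝ}, l ≤ x ∧ x ≤ u → s * l ≤ s * x ∧ s * x ≤ s * u :=
    fun h => ⟨mul_le_mul_of_nonneg_left h.1 hs0, mul_le_mul_of_nonneg_left h.2 hs0⟩
  have q1 := sb (pw 1 (by norm_num) hq hq')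
  have q2 := sb (pw 2 (by norm_num) hq hq')
  have q3 := sb (pw 3 (by norm_num) hq hq')
  have q4 := sb (pw 4 (by norm_num) hq hq')
  have q5 := sb (pw 5 (by norm_num) hq hq')
  have q6 := sb (pw 6 (by norm_num) hq hq')
  have p2 := pw 2 (by norm_num) hp hp'
  have p3 := pw 3 (by norm_num) hp hp'
  have p4 := pw 4 (by norm_num) hp hp'
  have p5 := pw 5 (by norm_num) hp hp'
  norm_num at q1 q2 q3 q4 q5 q6 p2 p3 p4 p5
  have h12 : HolesAtEnds α β (1 + s) 0.001 (p ^ 1 + s * q ^ 2) (W 1 2) := by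
    have hσ : p ^ 1 + s * q ^ 1 - (q - 1) * (s * q ^ 1) = p + 2 * (s * q) - s * q ^ 2 := by ring
    have := h11.union (V := W 1 2) (hW.keep' 1 1) (hW.shift' 1 1) hαβ (by linarith) (by linarith)
      (by rw [hσ]; linarith) (by rw [hσ]; left; constructor <;> linarith)
    convert this using 1
    ring
  have h22 : HolesAtEnds α β (1 + s) 0.001 (p ^ 2 + s * q ^ 2) (W 2 2) := by
    have hσ : p ^ 1 + s * q ^ 2 - (p - 1) * p ^ 1 = 2 * p + s * q ^ 2 - p ^ 2 := by ring
    have := h12.union (V := W 2 2) (hW.keep 1 2) (hW.shift 1 2) hαβ (by linarith) (by linarith)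
      (by rw [hσ]; linarith) (by rw [hσ]; right; left; constructor <;> linarith)
    convert this using 1
    ring
  have h23 : HolesAtEnds α β (1 + s) 0.001 (p ^ 2 + s * q ^ 3) (W 2 3) := by
    have hσ : p ^ 2 + s * q ^ 2 - (q - 1) * (s * q ^ 2) = p ^ 2 + 2 * (s * q ^ 2) - s * q ^ 3 := by
      ring
    have := h22.union (V := W 2 3) (hW.keep' 2 2) (hW.shift' 2 2) hαβ (by linarith) (by linarith)
      (by rw [hσ]; linarith) (by rw [hσ]; right; right; linarith)
    convert this using 1
    ring
  have h33 : HolesAtEnds α β (1 + s) 0.001 (p ^ 3 + s * q ^ 3) (W 3 3) := by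
    have hσ : p ^ 2 + s * q ^ 3 - (p - 1) * p ^ 2 = 2 * p ^ 2 + s * q ^ 3 - p ^ 3 := by ring
    have := h23.union (V := W 3 3) (hW.keep 2 3) (hW.shift 2 3) hαβ (by linarith) (by linarith)
      (by rw [hσ]; linarith) (by rw [hσ]; right; left; constructor <;> linarith)
    convert this using 1
    ring
  have hD : (q - 1) * s = s * q - s := by ring
  have l33 : Linked p q s ((q - 1) * s) W 3 3 := by
    intro r h1 h2
    exact h33 r (by linarith) (by linarith) (.of_lt (by linarith) (by linarith))
      (.of_lt (by linarith) (by linarith))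
  have l34 : Linked p q s ((q - 1) * s) W 3 4 := l33.succ_right hW (by
    have : p ^ 3 - (q - 2) * (s * q ^ 3) = p ^ 3 + 2 * (s * q ^ 3) - s * q ^ 4 := by ring
    linarith)
  have l35 : Linked p q s ((q - 1) * s) W 3 5 := l34.succ_right hW (by
    have : p ^ 3 - (q - 2) * (s * q ^ 4) = p ^ 3 + 2 * (s * q ^ 4) - s * q ^ 5 := by ring
    linarith)
  have l45 : Linked p q s ((q - 1) * s) W 4 5 := l35.succ_left hW (by
    have : s * q ^ 5 - (p - 2) * p ^ 3 = s * q ^ 5 + 2 * p ^ 3 - p ^ 4 := by ring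
    linarith)
  have l46 : Linked p q s ((q - 1) * s) W 4 6 := l45.succ_right hW (by
    have : p ^ 4 - (q - 2) * (s * q ^ 5) = p ^ 4 + 2 * (s * q ^ 5) - s * q ^ 6 := by ring
    linarith)
  exact l46.succ_left hW (by
    have : s * q ^ 6 - (p - 2) * p ^ 4 = s * q ^ 6 + 2 * p ^ 4 - p ^ 5 := by ring
    linarith)

/-- If the final configurations are missing only the holes, then all linked configurations on the
path up to `(30, 39)` are reached. -/
lemma linked_of_holes {γ s α β : ℝ} {W : ℕ → ℕ → ℝ → Prop} (hγ : γ = 1.0321)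
    (hW : BackwardClosed (γ ^ 40) (γ ^ 31) s W)
    (hs : 1.1349 ≤ s) (hs' : s ≤ 1.1581)
    (hα : 0.708 ≤ α) (hαβ : α ≤ β) (hβ : β ≤ 0.7176)
    (h0 : ∀ x, 0.001 ≤ x → x ≤ 1 + s - 0.001 → AvoidsHoles α β (1 + s) x → W 0 0 x) :
    Linked (γ ^ 40) (γ ^ 31) s ((γ ^ 31 - 1) * s) W 30 39 := by
  have hγ1 : 1 ≤ γ := by rw [hγ]; norm_num
  have hp : 3.53892 ≤ γ ^ 40 := by rw [hγ]; norm_num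
  have hp' : γ ^ 40 ≤ 3.53893 := by rw [hγ]; norm_num
  have hq : 2.66302 ≤ γ ^ 31 := by rw [hγ]; norm_num
  have hq' : γ ^ 31 ≤ 2.66303 := by rw [hγ]; norm_num
  have hγ8 : γ ^ 8 ≤ 1.2876 := by rw [hγ]; norm_num
  have hγ10 : 1.3715 ≤ γ ^ 10 := by rw [hγ]; norm_num
  have hs0 : 0 ≤ s := by linarith
  have l56 := linked_five_six_of_holes hW hp hp' hq hq' hs hs' hα hαβ hβ h0
  have hD : (γ ^ 31 - 1) * s ≤ 1.66303 * 1.1581 :=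
    mul_le_mul (by linarith) hs' hs0 (by norm_num)
  refine linked_along_path (N := 69) (i := 10) (j := 8) (A := 555) (c := 0.01) (d := 0.01)
    hγ1 (by linarith) hs0 hW le_rfl (by norm_num) l56 ?_ ?_ ?_ (by norm_num) ?_ ?_ (by norm_num)
    ?_ ?_ 30 39 (by norm_num) (by norm_num) (by norm_num) (by norm_num)
  · intro a b _ _ h _
    exact h
  · intro a b _ _ _ h
    exact h
  · intro a b h1 h2 h3
    have ha : 5 ≤ a := by omega
    have := pow_le_pow_right₀ (by linarith : 1 ≤ γ ^ 40) ha
    have h5 : (3.53892 : ℝ) ^ 5 ≤ (γ ^ 40) ^ 5 := pow_le_pow_left₀ (by norm_num) hp 5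
    norm_num at h5
    linarith
  · have := mul_le_mul hs hγ10 (by norm_num) hs0
    linarith
  · linarith
  · have h1 : s * γ ^ 8 ≤ 1.1581 * 1.2876 := mul_le_mul hs' hγ8 (by positivity) (by norm_num)
    have h2 : (γ ^ 31 - 2) * (s * γ ^ 8) ≤ 0.66303 * (1.1581 * 1.2876) :=
      mul_le_mul (by linarith) h1 (by positivity) (by norm_num)
    linarith
  · linarith

/-! ### The set and its interior -/

/-- The set `ℒ`, with `u = 1 / p`, `v = 1 / q` and `k = (1 - 1 / q) / q ^ 39`. -/
def linkedSet (γ s₁ s₂ u v k : ℝ) : Set (ℝ × ℝ) :=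
  {st | γ⁻¹ * s₂ ≤ st.1 ∧ st.1 ≤ γ * s₁ ∧ k * st.1 ≤ st.2 + st.1 ∧ st.2 + k * st.1 ≤ 1 ∧
    (st.2 + (1 - v + k) * st.1 ≤ 1 ∨ st.2 + k * st.1 ≤ u ∨ 1 - u ≤ st.2 + (v - k) * st.1) ∧
    (1 - u ≤ st.2 + (1 - k) * st.1 ∨ 0 ≤ st.2 + (v - k) * st.1 ∨
      st.2 + (1 - v + k) * st.1 ≤ u)}

lemma isCompact_linkedSet {γ s₁ s₂ u v k : ℝ} (hk : 0 ≤ k) (hs₂ : 0 ≤ γ⁻¹ * s₂) :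
    IsCompact (linkedSet γ s₁ s₂ u v k) := by
  refine IsCompact.of_isClosed_subset
    (isCompact_Icc (a := (γ⁻¹ * s₂, -(γ * s₁))) (b := (γ * s₁, 1))) ?_ ?_
  · simp only [linkedSet, Set.ofPred_and, Set.ofPred_or]
    refine IsClosed.inter ?_ <| IsClosed.inter ?_ <| IsClosed.inter ?_ <| IsClosed.inter ?_ <|
      IsClosed.inter (IsClosed.union ?_ (IsClosed.union ?_ ?_))
        (IsClosed.union ?_ (IsClosed.union ?_ ?_)) <;>
      exact isClosed_le (by fun_prop) (by fun_prop)
  · rintro ⟨s, t⟩ ⟨h1, h2, h3, h4, -, -⟩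
    dsimp only at h1 h2 h3 h4
    have : 0 ≤ k * s := mul_nonneg hk (hs₂.trans h1)
    exact ⟨⟨h1, by dsimp only; linarith⟩, ⟨h2, by dsimp only; linarith⟩⟩

/-- Outside the critical range of scales no hole has to be removed. -/
lemma mem_linkedSet_of_scale {γ s₁ s₂ u v k s t : ℝ}
    (h1 : γ⁻¹ * s₂ ≤ s) (h2 : s ≤ γ * s₁) (h3 : k * s ≤ t + s) (h4 : t + k * s ≤ 1)
    (h : s * (1 - 2 * v + 2 * k) ≤ u ∨ 1 - 2 * u ≤ s * (v - 2 * k)) :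
    (s, t) ∈ linkedSet γ s₁ s₂ u v k := by
  refine ⟨h1, h2, h3, h4, ?_, ?_⟩ <;> dsimp only
  · by_contra hcon
    push Not at hcon
    rcases h with h | h <;> linarith [hcon.1, hcon.2.1, hcon.2.2]
  · by_contra hcon
    push Not at hcon
    rcases h with h | h <;> linarith [hcon.1, hcon.2.1, hcon.2.2]

lemma mem_interior_linkedSet_of_scale {γ s₁ s₂ u v k s t : ℝ}
    (h1 : γ⁻¹ * s₂ < s) (h2 : s < γ * s₁) (h3 : k * s < t + s) (h4 : t + k * s < 1)
    (h : s * (1 - 2 * v + 2 * k) < u ∨ 1 - 2 * u < s * (v - 2 * k)) :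
    (s, t) ∈ interior (linkedSet γ s₁ s₂ u v k) := by
  refine mem_interior.2 ⟨{st | γ⁻¹ * s₂ < st.1 ∧ st.1 < γ * s₁ ∧ k * st.1 < st.2 + st.1 ∧
    st.2 + k * st.1 < 1 ∧
    (st.1 * (1 - 2 * v + 2 * k) < u ∨ 1 - 2 * u < st.1 * (v - 2 * k))}, ?_, ?_,
    ⟨h1, h2, h3, h4, h⟩⟩
  · rintro ⟨s, t⟩ ⟨h1, h2, h3, h4, h⟩
    exact mem_linkedSet_of_scale h1.le h2.le h3.le h4.le (h.imp le_of_lt le_of_lt)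
  · simp only [Set.ofPred_and, Set.ofPred_or]
    refine IsOpen.inter ?_ <| IsOpen.inter ?_ <| IsOpen.inter ?_ <| IsOpen.inter ?_ <|
      IsOpen.union ?_ ?_ <;>
      exact isOpen_lt (by fun_prop) (by fun_prop)

lemma mem_interior_linkedSet_of_avoidsHoles {γ s₁ s₂ u v k s t : ℝ}
    (h1 : γ⁻¹ * s₂ < s) (h2 : s < γ * s₁) (h3 : k * s < t + s) (h4 : t + k * s < 1)
    (h : AvoidsHoles (u + v * s - k * s) (1 - u + k * s) (1 + s) (1 - t)) :
    (s, t) ∈ interior (linkedSet γ s₁ s₂ u v k) := by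
  refine mem_interior.2 ⟨{st | γ⁻¹ * s₂ < st.1 ∧ st.1 < γ * s₁ ∧ k * st.1 < st.2 + st.1 ∧
    st.2 + k * st.1 < 1 ∧
    (1 - st.2 < u + v * st.1 - k * st.1 ∨ 1 - u + k * st.1 < 1 - st.2) ∧
    (1 - st.2 < 1 + st.1 - (1 - u + k * st.1) ∨
      1 + st.1 - (u + v * st.1 - k * st.1) < 1 - st.2)}, ?_, ?_, ⟨h1, h2, h3, h4, h.1, h.2⟩⟩
  · rintro ⟨s, t⟩ ⟨h1, h2, h3, h4, h5, h6⟩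
    dsimp only at h5 h6
    refine ⟨h1.le, h2.le, h3.le, h4.le, ?_, ?_⟩ <;> dsimp only
    · rcases h5 with h | h
      · exact Or.inr (Or.inr (by linarith))
      · exact Or.inr (Or.inl (by linarith))
    · rcases h6 with h | h
      · exact Or.inl (by linarith)
      · exact Or.inr (Or.inr (by linarith))
  · simp only [Set.ofPred_and, Set.ofPred_or]
    refine IsOpen.inter ?_ <| IsOpen.inter ?_ <| IsOpen.inter ?_ <| IsOpen.inter ?_ <|
      IsOpen.inter (IsOpen.union ?_ ?_) (IsOpen.union ?_ ?_) <;>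
      exact isOpen_lt (by fun_prop) (by fun_prop)

/-- A point of the set has one linked pair of children, so it inherits what holds for linked
configurations one step further in both directions. -/
lemma BackwardClosed.of_mem_linkedSet {γ s₁ s₂ p q k s s₀ t₀ : ℝ} {W : ℕ → ℕ → ℝ → Prop}
    {a b : ℕ} (hW : BackwardClosed p q s W) (hp : 0 < p) (hq : 0 < q)
    (hscale : s₀ * p ^ (a + 1) = s * q ^ (b + 1))
    (hlinked : Linked p q s (k * s₀ * p ^ (a + 1)) W a b)
    (hu : 1 - 2 * (1 / p) + 2 * (k * s₀) ≤ s₀) (hv : (1 - 2 * (1 / q)) * s₀ + 2 * (k * s₀) ≤ 1)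
    (hmem : (s₀, t₀) ∈ linkedSet γ s₁ s₂ (1 / p) (1 / q) k) :
    W (a + 1) (b + 1) (p ^ (a + 1) * (1 - t₀)) := by
  obtain ⟨-, -, h3, h4, h5, h6⟩ := hmem
  dsimp only at h3 h4 h5 h6
  have hP : 0 < p ^ (a + 1) := by positivity
  have eu : p ^ (a + 1) * (1 / p) = p ^ a := by field_simp; ring
  have ev : p ^ (a + 1) * (1 / q * s₀) = s * q ^ b := by
    rw [show p ^ (a + 1) * (1 / q * s₀) = s₀ * p ^ (a + 1) / q by ring, hscale]
    field_simp
    ring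
  have key : ∀ x, k * s₀ ≤ x → x ≤ 1 / p + 1 / q * s₀ - k * s₀ → W a b (p ^ (a + 1) * x) := by
    intro x hx1 hx2
    have e1 := mul_le_mul_of_nonneg_left hx1 hP.le
    have e2 := mul_le_mul_of_nonneg_left hx2 hP.le
    exact hlinked _ (by linarith) (by linarith)
  have sh : (p - 1) * p ^ a = p ^ (a + 1) * (1 - 1 / p) := by linarith [pow_succ p a]
  have sh' : (q - 1) * (s * q ^ b) = p ^ (a + 1) * ((1 - 1 / q) * s₀) := by
    have : s₀ * p ^ (a + 1) = s * (q ^ b * q) := by rw [hscale, pow_succ]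
    linarith
  have c00 (h : 1 - t₀ ≤ 1 / p + 1 / q * s₀ - k * s₀) :
      W (a + 1) (b + 1) (p ^ (a + 1) * (1 - t₀)) :=
    hW.keep' _ _ _ (hW.keep _ _ _ (key _ (by linarith) h))
  have c10 (h : 1 - 1 / p + k * s₀ ≤ 1 - t₀) (h' : 1 - t₀ ≤ 1 + 1 / q * s₀ - k * s₀) :
      W (a + 1) (b + 1) (p ^ (a + 1) * (1 - t₀)) := by
    refine hW.keep' _ _ _ (hW.shift _ _ _ ?_)
    rw [sh, ← mul_sub]
    exact key _ (by linarith) (by linarith)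
  have c01 (h : (1 - 1 / q) * s₀ + k * s₀ ≤ 1 - t₀) (h' : 1 - t₀ ≤ 1 / p + s₀ - k * s₀) :
      W (a + 1) (b + 1) (p ^ (a + 1) * (1 - t₀)) := by
    refine hW.shift' _ _ _ (hW.keep _ _ _ ?_)
    rw [sh', ← mul_sub]
    exact key _ (by linarith) (by linarith)
  have c11 (h : 1 - 1 / p + (1 - 1 / q) * s₀ + k * s₀ ≤ 1 - t₀) :
      W (a + 1) (b + 1) (p ^ (a + 1) * (1 - t₀)) := by
    refine hW.shift' _ _ _ (hW.shift _ _ _ ?_)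
    rw [sh, sh', ← mul_sub, ← mul_sub]
    exact key _ (by linarith) (by linarith)
  rcases h5 with h5 | h5 | h5
  · rcases h6 with h6 | h6 | h6
    · exact c01 (by linarith) (by linarith)
    · by_cases h : 1 - 1 / p + k * s₀ ≤ 1 - t₀
      · exact c10 h (by linarith)
      · exact c01 (by linarith) (by linarith)
    · exact c11 (by linarith)
  · rcases h6 with h6 | h6 | h6
    · by_cases h : (1 - 1 / q) * s₀ + k * s₀ ≤ 1 - t₀
      · exact c01 h (by linarith)
      · exact c10 (by linarith) (by linarith)
    · exact c10 (by linarith) (by linarith)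
    · exact c11 (by linarith)
  · exact c00 (by linarith)

/-! ### Recurrence -/

/-- The parameters of the theorem. -/
structure RenormData (γ p q s₁ s₂ k : ℝ) : Prop where
  γ_eq : γ = 1.0321
  p_eq : p = γ ^ 40
  q_eq : q = γ ^ 31
  k_eq : k = (1 - 1 / q) / q ^ 39
  s₁_eq : s₁ = (1 / p) / (1 - 2 * (1 / q) + 2 * k)
  s₂_eq : s₂ = (1 - 2 * (1 / p)) / (1 / q - 2 * k)

namespace RenormData

variable {γ p q s₁ s₂ k : ℝ}

lemma p_lower (d : RenormData γ p q s₁ s₂ k) : 3.53892 ≤ p := by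
  rw [d.p_eq, d.γ_eq]; norm_num

lemma p_upper (d : RenormData γ p q s₁ s₂ k) : p ≤ 3.53893 := by
  rw [d.p_eq, d.γ_eq]; norm_num

lemma q_lower (d : RenormData γ p q s₁ s₂ k) : 2.66302 ≤ q := by
  rw [d.q_eq, d.γ_eq]; norm_num

lemma q_upper (d : RenormData γ p q s₁ s₂ k) : q ≤ 2.66303 := by
  rw [d.q_eq, d.γ_eq]; norm_num

lemma p_pos (d : RenormData γ p q s₁ s₂ k) : 0 < p := by linarith [d.p_lower]

lemma q_pos (d : RenormData γ p q s₁ s₂ k) : 0 < q := by linarith [d.q_lower]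

lemma one_div_p (d : RenormData γ p q s₁ s₂ k) : 0.282571 ≤ 1 / p ∧ 1 / p ≤ 0.282572 := by
  rw [d.p_eq, d.γ_eq]; norm_num

lemma one_div_q (d : RenormData γ p q s₁ s₂ k) : 0.375512 ≤ 1 / q ∧ 1 / q ≤ 0.375514 := by
  rw [d.q_eq, d.γ_eq]; norm_num

lemma k_pos (d : RenormData γ p q s₁ s₂ k) : 0 < k := by
  rw [d.k_eq]
  have := d.q_pos
  exact div_pos (by linarith [d.one_div_q]) (by positivity)

lemma k_mul_pow_le (d : RenormData γ p q s₁ s₂ k) : k * p ^ 24 ≤ 0.001 := by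
  have hγ : (0 : ℝ) < γ := by rw [d.γ_eq]; norm_num
  have hpow : 1000 ≤ γ ^ 249 := by
    have h : (2 : ℝ) ≤ γ ^ 24 := by rw [d.γ_eq]; norm_num
    have h10 := pow_le_pow_left₀ (by norm_num) h 10
    have h1 : γ ^ 240 ≤ γ ^ 249 :=
      pow_le_pow_right₀ (by rw [d.γ_eq]; norm_num) (by norm_num)
    rw [← pow_mul] at h10
    norm_num at h10
    linarith
  have hq : q ^ 39 = p ^ 24 * γ ^ 249 := by rw [d.q_eq, d.p_eq]; ring
  have hp : 0 < p ^ 24 := pow_pos d.p_pos _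
  have : k * p ^ 24 = (1 - 1 / q) / γ ^ 249 := by
    rw [d.k_eq, hq]
    have := d.p_pos.ne'
    field_simp
  rw [this, div_le_iff₀ (by positivity)]
  linarith [d.one_div_q]

lemma k_le (d : RenormData γ p q s₁ s₂ k) : k ≤ 0.0000001 := by
  have h : (2 : ℝ) ^ 24 ≤ p ^ 24 :=
    pow_le_pow_left₀ (by norm_num) (by linarith [d.p_lower]) 24
  norm_num at h
  have := mul_le_mul_of_nonneg_left h d.k_pos.le
  linarith [d.k_mul_pow_le]

lemma le_s₁_iff (d : RenormData γ p q s₁ s₂ k) {s : ℝ} :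
    s ≤ s₁ ↔ s * (1 - 2 * (1 / q) + 2 * k) ≤ 1 / p := by
  rw [d.s₁_eq, le_div_iff₀]
  linarith [d.one_div_q, d.k_pos]

lemma s₂_le_iff (d : RenormData γ p q s₁ s₂ k) {s : ℝ} :
    s₂ ≤ s ↔ 1 - 2 * (1 / p) ≤ s * (1 / q - 2 * k) := by
  rw [d.s₂_eq, div_le_iff₀]
  linarith [d.one_div_q, d.k_le]

lemma lt_s₁_iff (d : RenormData γ p q s₁ s₂ k) {s : ℝ} :
    s < s₁ ↔ s * (1 - 2 * (1 / q) + 2 * k) < 1 / p := by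
  rw [d.s₁_eq, lt_div_iff₀]
  linarith [d.one_div_q, d.k_pos]

lemma s₂_lt_iff (d : RenormData γ p q s₁ s₂ k) {s : ℝ} :
    s₂ < s ↔ 1 - 2 * (1 / p) < s * (1 / q - 2 * k) := by
  rw [d.s₂_eq, div_lt_iff₀]
  linarith [d.one_div_q, d.k_le]

lemma s₁_bounds (d : RenormData γ p q s₁ s₂ k) : 1.1349 ≤ s₁ ∧ s₁ ≤ 1.135 := by
  have := d.one_div_p
  have := d.one_div_q
  have := d.k_pos
  have := d.k_le
  refine ⟨d.le_s₁_iff.2 (by linarith), not_lt.1 fun h => ?_⟩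
  linarith [d.lt_s₁_iff.1 h]

lemma s₂_bounds (d : RenormData γ p q s₁ s₂ k) : 1.158 ≤ s₂ ∧ s₂ ≤ 1.1581 := by
  have := d.one_div_p
  have := d.one_div_q
  have := d.k_pos
  have := d.k_le
  refine ⟨not_lt.1 fun h => ?_, d.s₂_le_iff.2 (by linarith)⟩
  linarith [d.s₂_lt_iff.1 h]

lemma inv_mul_s₂_lower (d : RenormData γ p q s₁ s₂ k) : 1.1219 ≤ γ⁻¹ * s₂ := by
  have h : 0.96889 ≤ γ⁻¹ := by rw [d.γ_eq]; norm_num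
  have := mul_le_mul h d.s₂_bounds.1 (by norm_num) (by linarith)
  linarith

lemma mul_s₁_upper (d : RenormData γ p q s₁ s₂ k) : γ * s₁ ≤ 1.1715 := by
  rw [d.γ_eq]
  linarith [d.s₁_bounds]

lemma inv_mul_s₂_lt_s₁ (d : RenormData γ p q s₁ s₂ k) : γ⁻¹ * s₂ < s₁ := by
  have h : γ⁻¹ ≤ 0.9689 := by rw [d.γ_eq]; norm_num
  have := mul_le_mul h d.s₂_bounds.2 (by linarith [d.s₂_bounds]) (by norm_num)
  linarith [d.s₁_bounds]

lemma s₂_lt_mul_s₁ (d : RenormData γ p q s₁ s₂ k) : s₂ < γ * s₁ := by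
  rw [d.γ_eq]
  linarith [d.s₁_bounds, d.s₂_bounds]

/-- From a point of `ℒ`, a path of operators ending at scale `s` reaches `U`, provided the linked
configurations along the path do. -/
lemma hitsIn_of_linked (d : RenormData γ p q s₁ s₂ k) {s s₀ t₀ : ℝ} {a b : ℕ}
    {U : Set (ℝ × ℝ)} (hscale : s₀ * p ^ (a + 1) = s * q ^ (b + 1))
    (hmem : (s₀, t₀) ∈ linkedSet γ s₁ s₂ (1 / p) (1 / q) k)
    (hlinked : BackwardClosed p q s (fun a b r =>
        HitsIn p q U (a + b) (s * q ^ b / p ^ a, 1 - r / p ^ a)) →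
      Linked p q s (k * s₀ * p ^ (a + 1)) (fun a b r =>
        HitsIn p q U (a + b) (s * q ^ b / p ^ a, 1 - r / p ^ a)) a b) :
    HitsIn p q U (a + 1 + (b + 1)) (s₀, t₀) := by
  have hp := d.p_pos
  have hq := d.q_pos
  have hW := backwardClosed_hitsIn s hp hq U
  have hs : 1.1219 ≤ s₀ := d.inv_mul_s₂_lower.trans hmem.1
  have hs' : s₀ ≤ 1.1715 := hmem.2.1.trans d.mul_s₁_upper
  have hks : k * s₀ ≤ 0.0000001 * 1.1715 := mul_le_mul d.k_le hs' (by linarith) (by norm_num)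
  have hqs : 0.375512 * 1.1219 ≤ 1 / q * s₀ :=
    mul_le_mul d.one_div_q.1 hs (by norm_num) (by linarith [d.one_div_q])
  have := hW.of_mem_linkedSet hp hq hscale (hlinked hW) (by linarith [d.one_div_p])
    (by linarith) hmem
  convert this using 2
  · rw [← hscale]
    field_simp
  · field_simp
    ring

lemma hitsIn_interior_of_critical (d : RenormData γ p q s₁ s₂ k) {s t : ℝ}
    (hmem : (s, t) ∈ linkedSet γ s₁ s₂ (1 / p) (1 / q) k) (hs : s₁ ≤ s) (hs' : s ≤ s₂) :
    HitsIn p q (interior (linkedSet γ s₁ s₂ (1 / p) (1 / q) k)) 71 (s, t) := by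
  have hp := d.p_pos
  have hq := d.q_pos
  have hs1 := d.s₁_bounds
  have hs2 := d.s₂_bounds
  have hu := d.one_div_p
  have hk := d.k_pos
  have hks : k * s ≤ 0.0000001 * 1.1581 :=
    mul_le_mul d.k_le (by linarith) (by linarith) (by norm_num)
  have hks0 : 0 ≤ k * s := mul_nonneg hk.le (by linarith)
  have hqs : 0.375512 * 1.1349 ≤ 1 / q * s :=
    mul_le_mul d.one_div_q.1 (by linarith) (by norm_num) (by linarith [d.one_div_q])
  have hpq : p ^ 31 = q ^ 40 := by rw [d.p_eq, d.q_eq]; ring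
  refine d.hitsIn_of_linked (a := 30) (b := 39) (s := s) (by rw [hpq]) hmem fun hW => ?_
  have hD : k * s * p ^ 31 = (q - 1) * s := by
    rw [hpq, d.k_eq]
    field_simp
  rw [hD]
  have hαβ := mt d.s₂_lt_iff.2 (not_lt.2 hs')
  rw [d.p_eq, d.q_eq] at hW ⊢
  refine linked_of_holes (α := 1 / p + 1 / q * s - k * s) (β := 1 - 1 / p + k * s) d.γ_eq hW
    (by linarith) (by linarith) (by linarith) (by linarith) (by linarith) ?_
  intro x hx1 hx2 hx
  refine ⟨[], rfl, by simp, ?_⟩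
  simp only [List.foldl_nil, pow_zero, mul_one, div_one]
  rw [← d.p_eq, ← d.q_eq]
  exact mem_interior_linkedSet_of_avoidsHoles (d.inv_mul_s₂_lt_s₁.trans_le hs)
    (hs'.trans_lt d.s₂_lt_mul_s₁) (by linarith) (by linarith) (by simpa using hx)

/-- The linked configurations of scale `s`. -/
def fiber (k s : ℝ) : Set (ℝ × ℝ) := {st | st.1 = s ∧ k * s < st.2 + s ∧ st.2 + k * s < 1}

lemma linked_zero_fiber {k s D : ℝ} (hD : k * s < D) (p q : ℝ) :
    Linked p q s D (fun a b r =>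
      HitsIn p q (fiber k s) (a + b) (s * q ^ b / p ^ a, 1 - r / p ^ a)) 0 0 := by
  intro r h1 h2
  refine ⟨[], rfl, by simp, ?_⟩
  simp only [List.foldl_nil, pow_zero, mul_one, div_one] at h2 ⊢
  exact ⟨rfl, by dsimp only; linarith, by dsimp only; linarith⟩

lemma hitsIn_fiber_up (d : RenormData γ p q s₁ s₂ k) {s t : ℝ}
    (hmem : (s, t) ∈ linkedSet γ s₁ s₂ (1 / p) (1 / q) k) (hs : s ≤ s₁) :
    HitsIn p q (fiber k (γ * s)) 16 (s, t) := by
  have hlow : 1.1219 ≤ s := d.inv_mul_s₂_lower.trans hmem.1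
  have hs1 := d.s₁_bounds
  have hk := d.k_pos
  have hγ1 : 1 ≤ γ := by rw [d.γ_eq]; norm_num
  have hγs : 1.158 ≤ γ * s := by
    have := (inv_mul_le_iff₀ (by linarith)).1 hmem.1
    exact d.s₂_bounds.1.trans this
  have hγs' : γ * s ≤ 1.1715 :=
    (mul_le_mul_of_nonneg_left hs (by linarith)).trans d.mul_s₁_upper
  have hks : 0 < k * s := mul_pos hk (by linarith)
  have hp7 : γ < p ^ 7 := by
    have := pow_le_pow_right₀ (by linarith [d.p_lower] : 1 ≤ p) (by norm_num : 1 ≤ 7)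
    rw [d.γ_eq]
    linarith [d.p_lower]
  have hp24 : k * p ^ 7 ≤ 0.001 :=
    (mul_le_mul_of_nonneg_left (pow_le_pow_right₀ (by linarith [d.p_lower]) (by norm_num))
      hk.le).trans d.k_mul_pow_le
  have hD : k * s * p ^ 7 ≤ 0.001 * 1.135 := by
    rw [mul_right_comm]
    exact mul_le_mul hp24 (by linarith) (by linarith) (by norm_num)
  have hD' : k * (γ * s) < k * s * p ^ 7 := by
    have := mul_lt_mul_of_pos_left hp7 hks
    linarith
  have hγ7 : γ ^ 7 ≤ 1.2476 := by rw [d.γ_eq]; norm_num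
  have hγ10 : 1.3715 ≤ γ ^ 10 := by rw [d.γ_eq]; norm_num
  have hpu := d.p_upper
  have hql := d.q_lower
  have hqu := d.q_upper
  refine d.hitsIn_of_linked (a := 6) (b := 8) (s := γ * s)
    (by rw [d.p_eq, d.q_eq]; ring) hmem fun hW => ?_
  have h0 := linked_zero_fiber hD' p q
  generalize k * s * p ^ (6 + 1) = D at *
  have hcD : 2 * D ≤ 0.03 * 1 := by linarith
  have hc : 0.03 ≤ γ * s * γ ^ 10 - (p - 2) := by
    have := mul_le_mul hγs hγ10 (by norm_num) (by linarith)
    linarith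
  have hd : 0.03 ≤ 1 - (q - 2) * (γ * s * γ ^ 7) := by
    have h1 : γ * s * γ ^ 7 ≤ 1.1715 * 1.2476 :=
      mul_le_mul hγs' hγ7 (by positivity) (by norm_num)
    have h2 : (q - 2) * (γ * s * γ ^ 7) ≤ 0.66303 * (1.1715 * 1.2476) :=
      mul_le_mul (by linarith) h1 (mul_nonneg (by linarith) (by positivity)) (by norm_num)
    linarith
  rw [d.p_eq] at hc
  rw [d.q_eq] at hd hql
  rw [d.p_eq, d.q_eq] at hW h0 ⊢
  refine linked_along_path (N := 14) (i := 10) (j := 7) (A := 1) (c := 0.03) (d := 0.03)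
    hγ1 (by linarith) (by linarith) hW (by norm_num) (by norm_num) h0 ?_ ?_ ?_ (by norm_num)
    hc hcD (by norm_num) hd hcD 6 8 (by norm_num) (by norm_num) (by norm_num) (by norm_num)
  · intro a b _ _ h _
    exact h
  · intro a b _ _ _ _
    push_cast
    omega
  · intro a b _ _ _
    exact one_le_pow₀ (one_le_pow₀ hγ1)

lemma hitsIn_fiber_down (d : RenormData γ p q s₁ s₂ k) {s t : ℝ}
    (hmem : (s, t) ∈ linkedSet γ s₁ s₂ (1 / p) (1 / q) k) (hs : s₂ ≤ s) :
    HitsIn p q (fiber k (γ⁻¹ * s)) 55 (s, t) := by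
  have hs2 := d.s₂_bounds
  have hup : s ≤ 1.1715 := hmem.2.1.trans d.mul_s₁_upper
  have hk := d.k_pos
  have hγ1 : 1 ≤ γ := by rw [d.γ_eq]; norm_num
  have hγ0 : γ ≠ 0 := by linarith
  have hγs : 1.1219 ≤ γ⁻¹ * s :=
    d.inv_mul_s₂_lower.trans (mul_le_mul_of_nonneg_left hs (by positivity))
  have hγs' : γ⁻¹ * s ≤ 1.135 :=
    ((inv_mul_le_iff₀ (by linarith)).2 hmem.2.1).trans d.s₁_bounds.2
  have hks : 0 < k * s := mul_pos hk (by linarith)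
  have hD : k * s * p ^ 24 ≤ 0.001 * 1.1715 := by
    rw [mul_right_comm]
    exact mul_le_mul d.k_mul_pow_le hup (by linarith) (by norm_num)
  have hD' : k * (γ⁻¹ * s) < k * s * p ^ 24 := by
    have h1 : k * (γ⁻¹ * s) ≤ k * s :=
      mul_le_mul_of_nonneg_left (by linarith) hk.le
    have h2 : 1 < p ^ 24 := one_lt_pow₀ (by linarith [d.p_lower]) (by norm_num)
    have := mul_lt_mul_of_pos_left h2 hks
    linarith
  have hγ8 : γ ^ 8 ≤ 1.2876 := by rw [d.γ_eq]; norm_num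
  have hγ11 : 1.4155 ≤ γ ^ 11 := by rw [d.γ_eq]; norm_num
  have hpu := d.p_upper
  have hql := d.q_lower
  have hqu := d.q_upper
  refine d.hitsIn_of_linked (a := 23) (b := 30) (s := γ⁻¹ * s)
    (by rw [d.p_eq, d.q_eq]; field_simp; ring) hmem fun hW => ?_
  have h0 := linked_zero_fiber hD' p q
  generalize k * s * p ^ (23 + 1) = D at *
  have hcD : 2 * D ≤ 0.03 * 1 := by linarith
  have hc : 0.03 ≤ γ⁻¹ * s * γ ^ 11 - (p - 2) := by
    have := mul_le_mul hγs hγ11 (by norm_num) (by linarith)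
    linarith
  have hd : 0.03 ≤ 1 - (q - 2) * (γ⁻¹ * s * γ ^ 8) := by
    have h1 : γ⁻¹ * s * γ ^ 8 ≤ 1.135 * 1.2876 :=
      mul_le_mul hγs' hγ8 (by positivity) (by norm_num)
    have h2 : (q - 2) * (γ⁻¹ * s * γ ^ 8) ≤ 0.66303 * (1.135 * 1.2876) :=
      mul_le_mul (by linarith) h1 (mul_nonneg (by linarith) (by positivity)) (by norm_num)
    linarith
  rw [d.p_eq] at hc
  rw [d.q_eq] at hd hql
  rw [d.p_eq, d.q_eq] at hW h0 ⊢
  refine linked_along_path (N := 53) (i := 11) (j := 8) (A := 1) (c := 0.03) (d := 0.03)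
    hγ1 (by linarith) (by linarith) hW (by norm_num) (by norm_num) h0 ?_ ?_ ?_ (by norm_num)
    hc hcD (by norm_num) hd hcD 23 30 (by norm_num) (by norm_num) (by norm_num) (by norm_num)
  · intro a b _ _ _ _
    push_cast
    omega
  · intro a b _ _ _ h
    exact h
  · intro a b _ _ _
    exact one_le_pow₀ (one_le_pow₀ hγ1)

lemma exists_hitsIn_interior (d : RenormData γ p q s₁ s₂ k) {x : ℝ × ℝ}
    (hx : x ∈ linkedSet γ s₁ s₂ (1 / p) (1 / q) k) :
    ∃ n, 1 ≤ n ∧ HitsIn p q (interior (linkedSet γ s₁ s₂ (1 / p) (1 / q) k)) n x := by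
  obtain ⟨s, t⟩ := x
  have hγ : 0 < γ := by rw [d.γ_eq]; norm_num
  rcases lt_or_ge s s₁ with h | h
  · have hup := d.hitsIn_fiber_up hx h.le
    have hlt : γ * s < γ * s₁ := mul_lt_mul_of_pos_left h hγ
    rcases ((inv_mul_le_iff₀ hγ).1 hx.1).eq_or_lt with heq | hgt
    · refine ⟨16 + 71, by norm_num, hup.trans ?_⟩
      rintro ⟨s', t'⟩ ⟨h1, h2, h3⟩
      obtain rfl : s' = s₂ := h1.trans heq.symm
      dsimp only at heq h2 h3
      rw [← heq] at h2 h3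
      exact d.hitsIn_interior_of_critical (mem_linkedSet_of_scale
        (d.inv_mul_s₂_lt_s₁.le.trans (by linarith [d.s₁_bounds, d.s₂_bounds]))
        d.s₂_lt_mul_s₁.le h2.le h3.le (Or.inr (d.s₂_le_iff.1 le_rfl)))
        (by linarith [d.s₁_bounds, d.s₂_bounds]) le_rfl
    · refine ⟨16, by norm_num, hup.mono ?_⟩
      rintro ⟨s', t'⟩ ⟨h1, h2, h3⟩
      dsimp only at h1 h2 h3
      subst h1
      exact mem_interior_linkedSet_of_scale (d.inv_mul_s₂_lt_s₁.trans
        (by linarith [d.s₁_bounds, d.s₂_bounds])) hlt h2 h3 (Or.inr (d.s₂_lt_iff.1 hgt))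
  rcases le_or_gt s s₂ with h' | h'
  · exact ⟨71, by norm_num, d.hitsIn_interior_of_critical hx h h'⟩
  · have hdown := d.hitsIn_fiber_down hx h'.le
    have hlt : γ⁻¹ * s₂ < γ⁻¹ * s := mul_lt_mul_of_pos_left h' (inv_pos.2 hγ)
    rcases ((inv_mul_le_iff₀ hγ).2 hx.2.1).eq_or_lt with heq | hgt
    · refine ⟨55 + 71, by norm_num, hdown.trans ?_⟩
      rintro ⟨s', t'⟩ ⟨h1, h2, h3⟩
      obtain rfl : s' = s₁ := h1.trans heq
      dsimp only at heq h2 h3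
      rw [heq] at h2 h3
      exact d.hitsIn_interior_of_critical (mem_linkedSet_of_scale d.inv_mul_s₂_lt_s₁.le
        (by linarith [d.s₁_bounds, d.s₂_bounds, d.s₂_lt_mul_s₁]) h2.le h3.le
        (Or.inl (d.le_s₁_iff.1 le_rfl))) le_rfl (by linarith [d.s₁_bounds, d.s₂_bounds])
    · refine ⟨55, by norm_num, hdown.mono ?_⟩
      rintro ⟨s', t'⟩ ⟨h1, h2, h3⟩
      dsimp only at h1 h2 h3 hgt
      subst h1
      exact mem_interior_linkedSet_of_scale hlt
        (by linarith [d.s₁_bounds, d.s₂_bounds, d.s₂_lt_mul_s₁]) h2 h3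
        (Or.inl (d.lt_s₁_iff.1 hgt))

end RenormData

/-- Theorem 2 of the paper (recurrence part). With `γ = 1.0321`, `p = γ^40`, `q = γ^31`,
`s₁, s₂` as in the paper, the operators `T₀(s,t) = (ps, pt)`, `T₁(s,t) = (ps, pt - p + 1)`,
`T₀'(s,t) = (s/q, t)`, `T₁'(s,t) = (s/q, t + ((q-1)/q) s)`, and
`ℒ = Δ \ (Δ₁ ∪ Δ₂)` as defined in the paper, the set `ℒ` is compact and recurrent:
every point of `ℒ` is sent into the interior of `ℒ` by some finite composition of the
four operators. -/
theorem L_recurrent_compact :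
    let γ : ℝ := 1.0321
    let p : ℝ := γ ^ 40
    let q : ℝ := γ ^ 31
    let s₁ : ℝ := (1 / p) / (1 - 2 / q + 2 * (1 - 1 / q) / q ^ 39)
    let s₂ : ℝ := (1 - 2 / p) / (1 / q - 2 * (1 - 1 / q) / q ^ 39)
    let T₀ : ℝ × ℝ → ℝ × ℝ := fun st => (p * st.1, p * st.2)
    let T₁ : ℝ × ℝ → ℝ × ℝ := fun st => (p * st.1, p * st.2 - p + 1)
    let T₀' : ℝ × ℝ → ℝ × ℝ := fun st => (st.1 / q, st.2)
    let T₁' : ℝ × ℝ → ℝ × ℝ := fun st => (st.1 / q, st.2 + (q - 1) / q * st.1)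
    let Δ : Set (ℝ × ℝ) := {st | γ⁻¹ * s₂ ≤ st.1 ∧ st.1 ≤ γ * s₁ ∧
      -st.1 + (1 - 1 / q) * st.1 / q ^ 39 ≤ st.2 ∧
      st.2 ≤ 1 - (1 - 1 / q) * st.1 / q ^ 39}
    let Δ₁ : Set (ℝ × ℝ) := {st | st.2 + (1 - 1 / q) * (1 + 1 / q ^ 39) * st.1 > 1 ∧
      st.2 + (1 - 1 / q) * st.1 / q ^ 39 > 1 / p ∧
      st.2 + (1 / q - (1 - 1 / q) / q ^ 39) * st.1 < 1 - 1 / p}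
    let Δ₂ : Set (ℝ × ℝ) := {st | st.2 + (1 - (1 - 1 / q) / q ^ 39) * st.1 < 1 - 1 / p ∧
      st.2 + (1 / q - (1 - 1 / q) / q ^ 39) * st.1 < 0 ∧
      st.2 + (1 - 1 / q) * (1 + 1 / q ^ 39) * st.1 > 1 / p}
    let ℒ : Set (ℝ × ℝ) := Δ \ (Δ₁ ∪ Δ₂)
    IsCompact ℒ ∧
      ∀ x ∈ ℒ, ∃ n : ℕ, 1 ≤ n ∧ ∃ f : Fin n → (ℝ × ℝ → ℝ × ℝ),
        (∀ i, f i ∈ ({T₀, T₁, T₀', T₁'} : Set (ℝ × ℝ → ℝ × ℝ))) ∧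
        (List.ofFn f).foldl (fun y g => g y) x ∈ interior ℒ := by
  intro γ p q s₁ s₂ T₀ T₁ T₀' T₁' Δ Δ₁ Δ₂ ℒ
  obtain ⟨k, hk⟩ : ∃ k, k = (1 - 1 / q) / q ^ 39 := ⟨_, rfl⟩
  have d : RenormData γ p q s₁ s₂ k := by
    refine ⟨rfl, rfl, rfl, hk, ?_, ?_⟩
    · rw [hk]
      simp only [s₁]
      ring
    · rw [hk]
      simp only [s₂]
      ring
  have hL : ℒ = linkedSet γ s₁ s₂ (1 / p) (1 / q) k := by
    ext ⟨s, t⟩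
    have e1 : (1 - 1 / q) * s / q ^ 39 = k * s := by rw [hk]; ring
    have e2 : (1 - 1 / q) * (1 + 1 / q ^ 39) = 1 - 1 / q + k := by rw [hk]; ring
    simp only [ℒ, Δ, Δ₁, Δ₂, linkedSet, Set.mem_sdiff, Set.mem_union, Set.mem_ofPred_eq, e1, e2,
      ← hk, not_or, not_and_or, not_lt, gt_iff_lt, and_assoc, neg_add_le_iff_le_add,
      le_sub_iff_add_le, add_comm s t]
  rw [hL]
  refine ⟨isCompact_linkedSet d.k_pos.le (by linarith [d.inv_mul_s₂_lower]), fun x hx => ?_⟩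
  obtain ⟨n, hn, l, rfl, hmem, hl⟩ := d.exists_hitsIn_interior hx
  exact ⟨l.length, hn, l.get, fun i => hmem _ (l.get_mem i), by rwa [List.ofFn_get]⟩
end

section
/- Let γ := 1.0321, p := γ^{40}, q := γ^{31}. Let C_p := { (1 − 1/p)·Σ_{i=0}^{∞} a_i/p^i : each a_i ∈ {0,1} } and C_q := { (1 − 1/q)·Σ_{i=0}^{∞} a_i/q^i : each a_i ∈ {0,1} } be the middle-α Cantor sets with ratios 1/p and 1/q. Then for every real number λ ≠ 0, the arithmetic difference C_p − λ·C_q := { x − λ y : x ∈ C_p, y ∈ C_q } contains a nonempty open interval. -/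
open Set

/-- The middle Cantor set with ratio `1 / r`. -/
def middleCantor (r : ℝ) : Set ℝ :=
  {x | ∃ a : ℕ → ℝ, (∀ i, a i = 0 ∨ a i = 1) ∧ x = (1 - 1 / r) * ∑' i : ℕ, a i / r ^ i}

section middleCantor

variable {r : ℝ}

lemma summable_digit_div_pow (hr : 1 < r) {a : ℕ → ℝ} (ha : ∀ i, a i = 0 ∨ a i = 1) :
    Summable fun i => a i / r ^ i := by
  have hr0 : 0 < r := by linarith
  refine Summable.of_nonneg_of_le (fun i => ?_) (fun i => ?_)
    (summable_geometric_of_lt_one (inv_nonneg.2 hr0.le) (inv_lt_one_of_one_lt₀ hr))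
  · rcases ha i with h | h <;> rw [h] <;> positivity
  · rcases ha i with h | h <;> rw [h, inv_pow]
    · rw [zero_div]; positivity
    · rw [one_div]

lemma zero_mem_middleCantor : (0 : ℝ) ∈ middleCantor r :=
  ⟨fun _ => 0, fun _ => Or.inl rfl, by simp⟩

lemma div_add_mem_middleCantor (hr : 1 < r) {x d : ℝ} (hx : x ∈ middleCantor r)
    (hd : d = 0 ∨ d = 1) : x / r + d * (1 - 1 / r) ∈ middleCantor r := by
  have hr0 : r ≠ 0 := by linarith
  obtain ⟨a, ha, rfl⟩ := hx
  let b : ℕ → ℝ := fun i => Nat.casesOn i d a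
  have hb : ∀ i, b i = 0 ∨ b i = 1 := fun i => by cases i with
    | zero => exact hd
    | succ n => exact ha n
  refine ⟨b, hb, ?_⟩
  rw [(summable_digit_div_pow hr hb).tsum_eq_zero_add]
  have h : ∀ i, b (i + 1) / r ^ (i + 1) = (a i / r ^ i) * r⁻¹ := fun i => by
    change a i / r ^ (i + 1) = _
    rw [pow_succ, ← div_div, div_eq_mul_inv (a i / r ^ i)]
  simp_rw [h, tsum_mul_right]
  change _ = (1 - 1 / r) * (d / r ^ 0 + _)
  field_simp
  ring

lemma one_sub_mem_middleCantor (hr : 1 < r) {x : ℝ} (hx : x ∈ middleCantor r) :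
    1 - x ∈ middleCantor r := by
  have hr0 : 0 < r := by linarith
  obtain ⟨a, ha, rfl⟩ := hx
  have hb : ∀ i, 1 - a i = 0 ∨ 1 - a i = 1 := fun i => by
    rcases ha i with h | h <;> simp [h]
  refine ⟨fun i => 1 - a i, hb, ?_⟩
  have h1 : ∑' i : ℕ, (1 : ℝ) / r ^ i = (1 - r⁻¹)⁻¹ := by
    simp_rw [one_div, ← inv_pow]
    exact tsum_geometric_of_lt_one (inv_nonneg.2 hr0.le) (inv_lt_one_of_one_lt₀ hr)
  have h2 : (1 : ℝ) - r⁻¹ ≠ 0 := by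
    have := inv_lt_one_of_one_lt₀ hr
    linarith
  simp_rw [sub_div]
  rw [Summable.tsum_sub (summable_digit_div_pow hr (fun _ => Or.inr rfl))
    (summable_digit_div_pow hr ha), h1, mul_sub, one_div, mul_inv_cancel₀ h2]

lemma isCompact_middleCantor (hr : 1 < r) : IsCompact (middleCantor r) := by
  have hr0 : 0 < r := by linarith
  have hK : IsCompact (Set.pi univ fun _ : ℕ => ({0, 1} : Set ℝ)) :=
    isCompact_univ_pi fun _ => (Set.toFinite _).isCompact
  have hc : ContinuousOn (fun a : ℕ → ℝ => (1 - 1 / r) * ∑' i : ℕ, a i / r ^ i)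
      (Set.pi univ fun _ : ℕ => ({0, 1} : Set ℝ)) := by
    refine continuousOn_const.mul (continuousOn_tsum (u := fun i => r⁻¹ ^ i) (fun i => ?_)
      (summable_geometric_of_lt_one (inv_nonneg.2 hr0.le) (inv_lt_one_of_one_lt₀ hr)) ?_)
    · exact ((continuous_apply i).div_const _).continuousOn
    · intro i a ha
      rcases ha i (mem_univ i) with h | h
      · rw [h, zero_div, norm_zero]; positivity
      · rw [mem_singleton_iff.1 h, one_div, inv_pow, Real.norm_of_nonneg (by positivity)]
  convert hK.image_of_continuousOn hc using 1
  ext x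
  simp only [middleCantor, mem_ofPred_eq, mem_image, mem_pi, mem_univ, true_implies,
    mem_insert_iff, mem_singleton_iff]
  exact ⟨fun ⟨a, h, e⟩ => ⟨a, h, e.symm⟩, fun ⟨a, h, e⟩ => ⟨a, h, e.symm⟩⟩

end middleCantor

/-- `s` is a point of `C_p - l C_q`, in the coordinate centred at the midpoint of the hull. -/
def IsDiff (p q l s : ℝ) : Prop :=
  ∃ x ∈ middleCantor p, ∃ y ∈ middleCantor q, s = (x - 1 / 2) - l * (y - 1 / 2)

/-- One renormalization step on pairs `(l, s)`: passing to a first-level piece of `C_p` or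
of `C_q`. -/
def RenormStep (p q : ℝ) (z w : ℝ × ℝ) : Prop :=
  (w.1 = p * z.1 ∧ (w.2 = p * z.2 - (p - 1) / 2 ∨ w.2 = p * z.2 + (p - 1) / 2)) ∨
  (w.1 = z.1 / q ∧ (w.2 = z.2 - z.1 * (1 - 1 / q) / 2 ∨ w.2 = z.2 + z.1 * (1 - 1 / q) / 2))

section renormalization

variable {p q : ℝ}

/-- Pulling a point of the product of the Cantor sets back along a renormalization step divides
the error of approximation by `p`, or leaves it unchanged. -/
lemma RenormStep.exists_pullback (hp : 1 < p) (hq : 1 < q) {z w : ℝ × ℝ}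
    (h : RenormStep p q z w) {x y : ℝ} (hx : x ∈ middleCantor p) (hy : y ∈ middleCantor q) :
    ∃ x' ∈ middleCantor p, ∃ y' ∈ middleCantor q,
      (w.1 = p * z.1 ∧ z.2 - ((x' - 1 / 2) - z.1 * (y' - 1 / 2)) =
        (w.2 - ((x - 1 / 2) - w.1 * (y - 1 / 2))) / p) ∨
      (w.1 = z.1 / q ∧ z.2 - ((x' - 1 / 2) - z.1 * (y' - 1 / 2)) =
        w.2 - ((x - 1 / 2) - w.1 * (y - 1 / 2))) := by
  have hp0 : p ≠ 0 := by linarith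
  have hq0 : q ≠ 0 := by linarith
  rcases h with ⟨h1, h2 | h2⟩ | ⟨h1, h2 | h2⟩
  · refine ⟨_, div_add_mem_middleCantor hp hx (Or.inr rfl), y, hy, Or.inl ⟨h1, ?_⟩⟩
    rw [h1, h2]; field_simp; ring
  · refine ⟨_, div_add_mem_middleCantor hp hx (Or.inl rfl), y, hy, Or.inl ⟨h1, ?_⟩⟩
    rw [h1, h2]; field_simp; ring
  · refine ⟨x, hx, _, div_add_mem_middleCantor hq hy (Or.inl rfl), Or.inr ⟨h1, ?_⟩⟩
    rw [h1, h2]; field_simp; ring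
  · refine ⟨x, hx, _, div_add_mem_middleCantor hq hy (Or.inr rfl), Or.inr ⟨h1, ?_⟩⟩
    rw [h1, h2]; field_simp; ring

lemma RenormStep.isDiff (hp : 1 < p) (hq : 1 < q) {z w : ℝ × ℝ} (h : RenormStep p q z w)
    (hw : IsDiff p q w.1 w.2) : IsDiff p q z.1 z.2 := by
  obtain ⟨x, hx, y, hy, e⟩ := hw
  obtain ⟨x', hx', y', hy', h⟩ := h.exists_pullback hp hq hx hy
  refine ⟨x', hx', y', hy', sub_eq_zero.1 ?_⟩
  rcases h with ⟨-, h⟩ | ⟨-, h⟩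
  · rw [h, e, sub_self, zero_div]
  · rw [h, e, sub_self]

lemma isClosed_setOf_isDiff (hp : 1 < p) (hq : 1 < q) (l : ℝ) :
    IsClosed {s | IsDiff p q l s} := by
  have hc : Continuous fun z : ℝ × ℝ => (z.1 - 1 / 2) - l * (z.2 - 1 / 2) := by fun_prop
  convert (((isCompact_middleCantor hp).prod (isCompact_middleCantor hq)).image hc).isClosed
    using 1
  ext s
  constructor
  · rintro ⟨x, hx, y, hy, e⟩
    exact ⟨(x, y), ⟨hx, hy⟩, e.symm⟩
  · rintro ⟨⟨x, y⟩, ⟨hx, hy⟩, e⟩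
    exact ⟨x, hx, y, hy, e.symm⟩

/-- A bounded set of pairs `(l, s)`, with `l` bounded away from `0`, in which every point has a
renormalization step staying in the set, consists of points of arithmetic differences. -/
lemma isDiff_of_recurrent (hp : 1 < p) (hq : 1 < q) {S : Set (ℝ × ℝ)} {c M : ℝ} (hc : 0 < c)
    (hS1 : ∀ z ∈ S, c ≤ z.1) (hS2 : ∀ z ∈ S, |z.2| + z.1 ≤ M)
    (hS : ∀ z ∈ S, ∃ w ∈ S, RenormStep p q z w) {z : ℝ × ℝ} (hz : z ∈ S) :
    IsDiff p q z.1 z.2 := by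
  have hp0 : 0 < p := by linarith
  have hq0 : 0 < q := by linarith
  set θ := max (√p)⁻¹ (√q)⁻¹ with hθ
  have hθ0 : 0 ≤ θ := le_max_of_le_left (by positivity)
  have hθ1 : θ < 1 := max_lt (inv_lt_one_of_one_lt₀ (Real.lt_sqrt_of_sq_lt (by linarith)))
    (inv_lt_one_of_one_lt₀ (Real.lt_sqrt_of_sq_lt (by linarith)))
  have approx : ∀ n : ℕ, ∀ z ∈ S, ∃ x ∈ middleCantor p, ∃ y ∈ middleCantor q,
      |z.2 - ((x - 1 / 2) - z.1 * (y - 1 / 2))| ≤ (M + 1) / √c * √z.1 * θ ^ n := by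
    intro n
    induction n with
    | zero =>
      intro z hz
      refine ⟨0, zero_mem_middleCantor, 0, zero_mem_middleCantor, ?_⟩
      have h1 := hS1 z hz
      have h2 := hS2 z hz
      have h3 : M + 1 ≤ (M + 1) / √c * √z.1 := by
        rw [div_mul_eq_mul_div, le_div_iff₀ (Real.sqrt_pos.2 hc)]
        have := abs_nonneg z.2
        exact mul_le_mul_of_nonneg_left (Real.sqrt_le_sqrt h1) (by linarith)
      rw [pow_zero, mul_one]
      refine le_trans (abs_le.2 ⟨?_, ?_⟩) h3 <;>
        linarith [neg_abs_le z.2, le_abs_self z.2]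
    | succ n ih =>
      intro z hz
      obtain ⟨w, hw, hzw⟩ := hS z hz
      obtain ⟨x, hx, y, hy, hxy⟩ := ih w hw
      have h1 := hS1 z hz
      have hM : 0 ≤ (M + 1) / √c := by
        have := hS2 z hz
        have := abs_nonneg z.2
        exact div_nonneg (by linarith) (Real.sqrt_nonneg c)
      obtain ⟨x', hx', y', hy', ⟨h, e⟩ | ⟨h, e⟩⟩ := hzw.exists_pullback hp hq hx hy
      · refine ⟨x', hx', y', hy', ?_⟩
        rw [e, abs_div, abs_of_pos hp0]
        have h4 : √w.1 / p = (√p)⁻¹ * √z.1 := by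
          rw [h, Real.sqrt_mul hp0.le, div_eq_iff hp0.ne', eq_comm]
          calc (√p)⁻¹ * √z.1 * p = (√p)⁻¹ * √z.1 * (√p * √p) := by
                rw [Real.mul_self_sqrt hp0.le]
            _ = √p * √z.1 := by
                have := (Real.sqrt_pos.2 hp0).ne'
                field_simp
        calc _ ≤ (M + 1) / √c * √w.1 * θ ^ n / p := by gcongr
          _ = (M + 1) / √c * (√w.1 / p) * θ ^ n := by ring
          _ = (M + 1) / √c * √z.1 * (θ ^ n * (√p)⁻¹) := by rw [h4]; ring
          _ ≤ (M + 1) / √c * √z.1 * (θ ^ n * θ) := by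
              gcongr
              exact le_max_left _ _
          _ = _ := by rw [pow_succ]
      · refine ⟨x', hx', y', hy', ?_⟩
        rw [e]
        calc _ ≤ (M + 1) / √c * √w.1 * θ ^ n := hxy
          _ = (M + 1) / √c * √z.1 * (θ ^ n * (√q)⁻¹) := by
              rw [h, Real.sqrt_div (by linarith)]; ring
          _ ≤ (M + 1) / √c * √z.1 * (θ ^ n * θ) := by
              gcongr
              exact le_max_right _ _
          _ = _ := by rw [pow_succ]
  have hlim : Filter.Tendsto (fun n : ℕ => (M + 1) / √c * √z.1 * θ ^ n) Filter.atTop (nhds 0) := by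
    simpa using (tendsto_pow_atTop_nhds_zero_of_lt_one hθ0 hθ1).const_mul ((M + 1) / √c * √z.1)
  refine (isClosed_setOf_isDiff hp hq z.1).closure_subset (Metric.mem_closure_iff.2 ?_)
  intro ε hε
  obtain ⟨n, hn⟩ := (hlim.eventually (gt_mem_nhds hε)).exists
  obtain ⟨x, hx, y, hy, h⟩ := approx n z hz
  exact ⟨_, ⟨x, hx, y, hy, rfl⟩, by rw [Real.dist_eq]; exact h.trans_lt hn⟩

/-- The arithmetic difference `C_p - l C_q` contains a nonempty open interval (in centred
coordinates). -/
def HasInterval (p q l : ℝ) : Prop := ∃ u v : ℝ, u < v ∧ Ioo u v ⊆ {s | IsDiff p q l s}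

lemma HasInterval.of_mul (hp : 1 < p) (hq : 1 < q) {l : ℝ} (h : HasInterval p q (p * l)) :
    HasInterval p q l := by
  have hp0 : 0 < p := by linarith
  obtain ⟨u, v, huv, h⟩ := h
  refine ⟨(u + (p - 1) / 2) / p, (v + (p - 1) / 2) / p, by gcongr, fun s hs => ?_⟩
  have h1 := (div_lt_iff₀ hp0).1 hs.1
  have h2 := (lt_div_iff₀ hp0).1 hs.2
  exact RenormStep.isDiff hp hq (z := (l, s)) (w := (p * l, p * s - (p - 1) / 2))
    (Or.inl ⟨rfl, Or.inl rfl⟩) (h ⟨by linarith, by linarith⟩)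

lemma HasInterval.of_div (hp : 1 < p) (hq : 1 < q) {l : ℝ} (h : HasInterval p q (l / q)) :
    HasInterval p q l := by
  obtain ⟨u, v, huv, h⟩ := h
  refine ⟨u + l * (1 - 1 / q) / 2, v + l * (1 - 1 / q) / 2, by gcongr, fun s hs => ?_⟩
  exact RenormStep.isDiff hp hq (z := (l, s)) (w := (l / q, s - l * (1 - 1 / q) / 2))
    (Or.inr ⟨rfl, Or.inl rfl⟩) (h ⟨by linarith [hs.1], by linarith [hs.2]⟩)

lemma HasInterval.of_pow_mul_div_pow (hp : 1 < p) (hq : 1 < q) (m n : ℕ) {l : ℝ}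
    (h : HasInterval p q (p ^ m * (l / q ^ n))) : HasInterval p q l := by
  have hmul : ∀ (m : ℕ) {l : ℝ}, HasInterval p q (p ^ m * l) → HasInterval p q l := by
    intro m
    induction m with
    | zero => intro l h; simpa using h
    | succ m ih =>
      intro l h
      refine HasInterval.of_mul hp hq (ih ?_)
      rwa [← mul_assoc, ← pow_succ]
  have hdiv : ∀ (n : ℕ) {l : ℝ}, HasInterval p q (l / q ^ n) → HasInterval p q l := by
    intro n
    induction n with
    | zero => intro l h; simpa using h
    | succ n ih =>
      intro l h
      refine HasInterval.of_div hp hq (ih ?_)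
      rwa [div_div, ← pow_succ']
  exact hdiv n (hmul m h)

end renormalization

/-- The common base of the two contraction ratios. -/
noncomputable def base : ℝ := 1.0321

lemma one_lt_base : 1 < base := by norm_num [base]

lemma base_pow_le_base_pow {m n : ℕ} (h : m ≤ n) : base ^ m ≤ base ^ n :=
  pow_le_pow_right₀ one_lt_base.le h

lemma base_pow_pos (n : ℕ) : 0 < base ^ n := pow_pos (by linarith [one_lt_base]) n

lemma one_lt_base_pow {n : ℕ} (h : n ≠ 0) : 1 < base ^ n := one_lt_pow₀ one_lt_base h

lemma base_pow_forty_mem : base ^ 40 ∈ Icc (3.538923 : ℝ) 3.538924 := by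
  constructor <;> norm_num [base]

/-- A pair of choices made for `|s|` can be mirrored for `s`. -/
lemma exists_signed_choice {Q : ℝ → Prop} {a s d : ℝ} (ha : 0 ≤ a) (hd : 0 ≤ d)
    (h : Q |a * |s| - d| ∨ Q (a * |s| + d)) :
    ∃ t, (t = a * s - d ∨ t = a * s + d) ∧ Q |t| := by
  rcases abs_cases s with ⟨hs, hs'⟩ | ⟨hs, hs'⟩ <;> rw [hs] at h <;> rcases h with h | h
  · exact ⟨_, Or.inl rfl, h⟩
  · refine ⟨_, Or.inr rfl, ?_⟩
    rwa [abs_of_nonneg (by positivity)]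
  · refine ⟨_, Or.inr rfl, ?_⟩
    rwa [← abs_neg, neg_add, ← sub_eq_add_neg, ← mul_neg]
  · refine ⟨_, Or.inl rfl, ?_⟩
    have : 0 ≤ a * -s := mul_nonneg ha (by linarith)
    rwa [abs_of_nonpos (by linarith), neg_sub, sub_eq_neg_add, ← mul_neg]

/-- Points whose levels `k ≤ 70` (standing for the parameter `l * base ^ k`) satisfy a symmetric
condition `Q` preserved by the renormalization steps `k ↦ k + 40` and `k ↦ k - 31` belong to the
arithmetic difference. -/
lemma isDiff_of_levels {l : ℝ} (hl : 0 < l) {Q : ℕ → ℝ → Prop}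
    (hb : ∀ k ≤ 70, ∀ u, Q k u → u ≤ (1 + l * base ^ k) / 2)
    (hx : ∀ k ≤ 30, ∀ u, 0 ≤ u → Q k u → Q (k + 40) |base ^ 40 * u - (base ^ 40 - 1) / 2| ∨
      Q (k + 40) (base ^ 40 * u + (base ^ 40 - 1) / 2))
    (hy : ∀ k ≤ 39, ∀ u, 0 ≤ u → Q (k + 31) u →
      Q k |u - l * (base ^ (k + 31) - base ^ k) / 2| ∨
      Q k (u + l * (base ^ (k + 31) - base ^ k) / 2))
    {k : ℕ} (hk : k ≤ 70) {s : ℝ} (hs : Q k |s|) :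
    IsDiff (base ^ 40) (base ^ 31) (l * base ^ k) s := by
  have hp := one_lt_base_pow (n := 40) (by norm_num)
  have hq := one_lt_base_pow (n := 31) (by norm_num)
  refine isDiff_of_recurrent (S := {z | ∃ k ≤ 70, z.1 = l * base ^ k ∧ Q k |z.2|}) (c := l)
    (M := (1 + l * base ^ 70) / 2 + l * base ^ 70) (z := (l * base ^ k, s)) hp hq hl
    ?_ ?_ ?_ ⟨k, hk, rfl, hs⟩
  · rintro z ⟨k, -, h, -⟩
    rw [h]
    exact le_mul_of_one_le_right hl.le (one_le_pow₀ one_lt_base.le)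
  · rintro z ⟨k, hk, h, hQ⟩
    have h1 := hb k hk _ hQ
    have h2 := mul_le_mul_of_nonneg_left (base_pow_le_base_pow hk) hl.le
    rw [h]
    linarith
  · rintro ⟨-, s⟩ ⟨k, hk, rfl, hQ⟩
    have hb0 : base ≠ 0 := by linarith [one_lt_base]
    rcases Nat.lt_or_ge 30 k with h | h
    · obtain ⟨j, rfl⟩ : ∃ j, k = j + 31 := ⟨k - 31, by omega⟩
      have e1 : l * base ^ j = l * base ^ (j + 31) / base ^ 31 := by
        rw [pow_add, ← mul_assoc, mul_div_cancel_right₀ _ (pow_ne_zero 31 hb0)]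
      have e2 : l * base ^ (j + 31) * (1 - 1 / base ^ 31) / 2 =
          l * (base ^ (j + 31) - base ^ j) / 2 := by
        rw [mul_sub, mul_one_div, ← e1, mul_one, mul_sub]
      have hd : 0 ≤ l * (base ^ (j + 31) - base ^ j) / 2 := by
        have := base_pow_le_base_pow (Nat.le_add_right j 31)
        exact div_nonneg (mul_nonneg hl.le (by linarith)) zero_le_two
      obtain ⟨t, ht, hQt⟩ := exists_signed_choice (Q := Q j) (s := s) zero_le_one hd
        (by simpa only [one_mul] using hy j (by omega) _ (abs_nonneg s) hQ)
      exact ⟨(l * base ^ j, t), ⟨j, by omega, rfl, hQt⟩,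
        Or.inr ⟨e1, by simpa only [e2, one_mul] using ht⟩⟩
    · obtain ⟨t, ht, hQt⟩ := exists_signed_choice (Q := Q (k + 40)) (by linarith) (by linarith)
        (hx k h _ (abs_nonneg s) hQ)
      exact ⟨(l * base ^ (k + 40), t), ⟨k + 40, by omega, rfl, hQt⟩, Or.inl ⟨by ring, ht⟩⟩

/-- The step `k ↦ k + 40` maps a hull shortened by `δ` onto a hull shortened by `ε`. -/
lemma abs_mul_sub_le {p l u δ ε : ℝ} (hp : 0 < p) (hu : 0 ≤ u) (hul : u ≤ (1 + l) / 2 - δ)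
    (hε : ε ≤ p * δ) (h : (p - 1) / 2 + ε ≤ (1 + p * l) / 2) :
    |p * u - (p - 1) / 2| ≤ (1 + p * l) / 2 - ε := by
  have h1 := mul_le_mul_of_nonneg_left hul hp.le
  have h2 := mul_nonneg hp.le hu
  exact abs_le.2 ⟨by linarith, by linarith⟩

/-- The step `k ↦ k - 31` maps a hull shortened by `δ` onto a hull shortened by `ε`. -/
lemma abs_sub_le_of_hull {l m u δ ε : ℝ} (hu : 0 ≤ u) (hul : u ≤ (1 + m) / 2 - δ)
    (hε : ε ≤ δ) (h : (m - l) / 2 + ε ≤ (1 + l) / 2) :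
    |u - (m - l) / 2| ≤ (1 + l) / 2 - ε :=
  abs_le.2 ⟨by linarith, by linarith⟩

/-- For parameters in the window where no first-level gap opens, the difference set is its full
hull. -/
lemma hasInterval_of_no_gap {l : ℝ} (hl1 : base ^ 40 - 2 ≤ base ^ 40 * l)
    (hl2 : l * base ^ 70 * (base ^ 31 - 2) ≤ base ^ 31) :
    HasInterval (base ^ 40) (base ^ 31) l := by
  obtain ⟨hp1, hp2⟩ := base_pow_forty_mem
  have hl : 0 < l := by
    by_contra! h
    nlinarith
  have main : ∀ s, |s| ≤ (1 + l * base ^ 0) / 2 →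
      IsDiff (base ^ 40) (base ^ 31) (l * base ^ 0) s := fun s hs => by
    refine isDiff_of_levels hl (Q := fun k u => u ≤ (1 + l * base ^ k) / 2)
      (fun _ _ _ h => h) ?_ ?_ (by norm_num) hs
    · intro k _ u hu h
      left
      have := abs_mul_sub_le (p := base ^ 40) (δ := 0) (ε := 0) (by linarith) hu (by linarith)
        (by simp) (by
          have := mul_le_mul_of_nonneg_left (one_le_pow₀ one_lt_base.le (n := k))
            (by positivity : 0 ≤ base ^ 40 * l)
          linarith : (base ^ 40 - 1) / 2 + 0 ≤ (1 + base ^ 40 * (l * base ^ k)) / 2)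
      rw [show l * base ^ (k + 40) = base ^ 40 * (l * base ^ k) by ring]
      linarith
    · intro k hk u hu h
      left
      have h1 : l * base ^ k * base ^ 31 * (base ^ 31 - 2) ≤ 1 * base ^ 31 := by
        have h2 := mul_le_mul_of_nonneg_left (base_pow_le_base_pow (show k + 31 ≤ 70 by omega))
          hl.le
        have h3 : 0 ≤ base ^ 31 - 2 := by norm_num [base]
        have := mul_le_mul_of_nonneg_right h2 h3
        rw [pow_add, ← mul_assoc] at this
        linarith
      have h4 : l * base ^ k * (base ^ 31 - 2) ≤ 1 :=
        le_of_mul_le_mul_right (by linarith) (base_pow_pos 31)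
      have := abs_sub_le_of_hull (l := l * base ^ k) (m := l * base ^ (k + 31)) (δ := 0) (ε := 0)
        hu (by linarith) le_rfl (by rw [pow_add]; linarith)
      rw [mul_sub]
      linarith
  refine ⟨-(1 + l) / 2, (1 + l) / 2, by linarith, fun s hs => ?_⟩
  simpa using main s (by
    rw [pow_zero, mul_one]
    exact abs_le.2 ⟨by linarith [hs.1], hs.2.le⟩)

/-- The amount by which the hull at level `k` is shortened. -/
noncomputable def hullMargin (k : ℕ) : ℝ :=
  if k = 4 ∨ k = 35 ∨ k = 66 then 0.0373 else if k = 26 ∨ k = 57 then 0.0106 else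
    if k = 17 ∨ k = 48 then 0.003 else 0.00085

/-- The region of centred coordinates kept at level `k` when a small gap opens at level `0`: at
the last levels before the gap, neighbourhoods of its preimages are removed from the hull, and at
the remaining levels the hull is shortened. -/
def GapAvoiding (l : ℝ) (k : ℕ) (u : ℝ) : Prop :=
  if k = 0 then (0.43486 - l) / 2 + 0.00025 ≤ u ∧ u ≤ (1 + l) / 2 - 0.00025
  else if k = 31 then u ≤ 0.3552 ∨ 0.3622 ≤ u ∧ u ≤ 1.0667
  else if k = 62 then u ≤ 0.5814 ∨ 0.6079 ≤ u ∧ u ≤ 1.2988 ∨ 1.3253 ≤ u ∧ u ≤ 2.0103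
  else if k = 22 then u ≤ 0.5229 ∨ 0.5306 ≤ u ∧ u ≤ 0.7256 ∨ 0.7333 ≤ u ∧ u ≤ 0.9267
  else if k = 53 then u ≤ 1.2330 ∨ 1.2553 ≤ u ∧ u ≤ 1.4357
  else if k = 13 then u ≤ 0.7070 ∨ 0.7136 ≤ u ∧ u ≤ 0.7643
  else if k = 44 then u ≤ 1.2413 ∨ 1.2589 ≤ u ∧ u ≤ 1.2986
  else u ≤ (1 + l * base ^ k) / 2 - hullMargin k

lemma gapAvoiding_iff_of_hull {l u : ℝ} {k : ℕ} (h0 : k ≠ 0) (h31 : k ≠ 31) (h62 : k ≠ 62)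
    (h22 : k ≠ 22) (h53 : k ≠ 53) (h13 : k ≠ 13) (h44 : k ≠ 44) :
    GapAvoiding l k u ↔ u ≤ (1 + l * base ^ k) / 2 - hullMargin k := by
  simp only [GapAvoiding, h0, h31, h62, h22, h53, h13, h44, if_false]

lemma hullMargin_pos (k : ℕ) : 0 < hullMargin k := by
  unfold hullMargin
  split_ifs <;> norm_num

section gap

variable {l : ℝ}

lemma GapAvoiding.le_hull (hl : 0.42618 ≤ l) {k : ℕ} {u : ℝ} (h : GapAvoiding l k u) :
    u ≤ (1 + l * base ^ k) / 2 := by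
  have key : ∀ {c d : ℝ}, c ≤ base ^ k → 0 ≤ c → u ≤ d → 2 * d ≤ 1 + 0.42618 * c →
      u ≤ (1 + l * base ^ k) / 2 := fun hc hc0 hu hd => by
    have := mul_le_mul hl hc hc0 (by linarith)
    linarith
  unfold GapAvoiding at h
  split_ifs at h
  · subst k; rw [pow_zero]; linarith [h.2]
  · refine key (c := 2.66302) (d := 1.0667) ?_ (by norm_num) ?_ (by norm_num)
    · subst k; norm_num [base]
    · rcases h with h | h <;> linarith
  · refine key (c := 7.0916) (d := 2.0103) ?_ (by norm_num) ?_ (by norm_num)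
    · subst k; norm_num [base]
    · rcases h with h | h | h <;> linarith
  · refine key (c := 2.0038) (d := 0.9267) ?_ (by norm_num) ?_ (by norm_num)
    · subst k; norm_num [base]
    · rcases h with h | h | h <;> linarith
  · refine key (c := 5.33) (d := 1.4357) ?_ (by norm_num) ?_ (by norm_num)
    · subst k; norm_num [base]
    · rcases h with h | h <;> linarith
  · refine key (c := 1.5) (d := 0.7643) ?_ (by norm_num) ?_ (by norm_num)
    · subst k; norm_num [base]
    · rcases h with h | h <;> linarith
  · refine key (c := 4) (d := 1.2986) ?_ (by norm_num) ?_ (by norm_num)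
    · subst k; norm_num [base]
    · rcases h with h | h <;> linarith
  · linarith [hullMargin_pos k]

lemma GapAvoiding.step_mul (hl1 : 0.42618 ≤ l) (hl2 : l ≤ 0.43486) {k : ℕ} (hk : k ≤ 30)
    {u : ℝ} (hu : 0 ≤ u) (h : GapAvoiding l k u) :
    GapAvoiding l (k + 40) |base ^ 40 * u - (base ^ 40 - 1) / 2| ∨
      GapAvoiding l (k + 40) (base ^ 40 * u + (base ^ 40 - 1) / 2) := by
  have hpow : l * base ^ (k + 40) = base ^ 40 * (l * base ^ k) := by ring
  have h4 : base ^ 4 ≤ 1.13472 := by norm_num [base]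
  have h17 : 1.7 ≤ base ^ 17 := by norm_num [base]
  have hbase : base = 1.0321 := rfl
  obtain ⟨hp1, hp2⟩ := base_pow_forty_mem
  generalize base ^ 40 = p at *
  have hp0 : 0 ≤ p := by linarith
  have up : ∀ {c}, u ≤ c → p * u ≤ 3.538924 * c := fun hc =>
    mul_le_mul hp2 hc hu (by norm_num)
  have low : ∀ {c}, c ≤ u → 0 ≤ c → 3.538923 * c ≤ p * u := fun hc hc0 =>
    mul_le_mul hp1 hc hc0 hp0
  have hx0 : 0 ≤ p * u := mul_nonneg hp0 hu
  by_cases k0 : k = 0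
  · subst k0
    left
    simp only [GapAvoiding, if_true] at h
    rw [gapAvoiding_iff_of_hull (by norm_num) (by norm_num) (by norm_num) (by norm_num)
      (by norm_num) (by norm_num) (by norm_num), hpow]
    have h1 := mul_le_mul_of_nonneg_left h.1 hp0
    have h2 := mul_le_mul_of_nonneg_left h.2 hp0
    norm_num [hullMargin]
    exact abs_le.2 ⟨by linarith, by linarith⟩
  by_cases k22 : k = 22
  · subst k22
    norm_num [GapAvoiding] at h ⊢
    generalize p * u = x at *
    rcases h with h | ⟨h, h'⟩ | ⟨h, h'⟩
    · have := up h
      rcases abs_cases (x - (p - 1) / 2) with ⟨e, _⟩ | ⟨e, _⟩ <;> rw [e]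
      · left; left; linarith
      · by_cases c1 : -(x - (p - 1) / 2) ≤ 0.5814
        · left; left; linarith
        · by_cases c2 : 0.6079 ≤ -(x - (p - 1) / 2)
          · left; right; left; constructor <;> linarith
          · right; right; right; constructor <;> linarith
    · have := up h'
      have := low h (by norm_num)
      rw [abs_of_nonneg (by linarith)]
      left; right; left; constructor <;> linarith
    · have := up h'
      have := low h (by norm_num)
      rw [abs_of_nonneg (by linarith)]
      left; right; right; constructor <;> linarith
  by_cases k13 : k = 13
  · subst k13
    norm_num [GapAvoiding] at h ⊢
    generalize p * u = x at *
    rcases h with h | ⟨h, h'⟩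
    · have := up h
      rcases abs_cases (x - (p - 1) / 2) with ⟨e, _⟩ | ⟨e, _⟩ <;> rw [e]
      · left; left; linarith
      · by_cases c1 : -(x - (p - 1) / 2) ≤ 1.2330
        · left; left; linarith
        · right; right; constructor <;> linarith
    · have := up h'
      have := low h (by norm_num)
      rw [abs_of_nonneg (by linarith)]
      left; right; constructor <;> linarith
  by_cases k4 : k = 4
  · subst k4
    norm_num [GapAvoiding, hullMargin] at h ⊢
    have hl4 : l * base ^ 4 ≤ 0.43486 * 1.13472 :=
      mul_le_mul hl2 h4 (base_pow_pos 4).le (by norm_num)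
    have := up (c := 0.70945) (by linarith)
    generalize p * u = x at *
    rcases abs_cases (x - (p - 1) / 2) with ⟨e, _⟩ | ⟨e, _⟩ <;> rw [e]
    · left; left; linarith
    · by_cases c1 : -(x - (p - 1) / 2) ≤ 1.2413
      · left; left; linarith
      · right; right; constructor <;> linarith
  · left
    rw [gapAvoiding_iff_of_hull (by omega) (by omega) (by omega) k22 (by omega) k13 (by omega)]
      at h
    rw [gapAvoiding_iff_of_hull (by omega) (by omega) (by omega) (by omega) (by omega) (by omega)
      (by omega), hpow]
    refine abs_mul_sub_le (by linarith) hu h ?_ ?_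
    · unfold hullMargin
      split_ifs <;> first | omega | linarith
    · have hge : ∀ {j : ℕ}, j ≤ k → 0.42618 * base ^ j ≤ l * base ^ k := fun hj =>
        mul_le_mul hl1 (base_pow_le_base_pow hj) (base_pow_pos _).le (by linarith)
      by_cases hk17 : 17 ≤ k
      · have hm : hullMargin (k + 40) ≤ 0.0373 := by
          unfold hullMargin
          split_ifs <;> norm_num
        have h2 : 0.7 ≤ l * base ^ k := by linarith [hge hk17]
        have h3 := mul_le_mul hp1 h2 (by norm_num) hp0
        linarith
      · have hm : hullMargin (k + 40) ≤ 0.003 := by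
          unfold hullMargin
          split_ifs <;> first | omega | norm_num
        have h2 : 0.42618 * 1.0321 ≤ l * base ^ k := by
          have := hge (j := 1) (by omega)
          rwa [pow_one, hbase] at this
        have h3 := mul_le_mul hp1 h2 (by norm_num) hp0
        linarith

lemma GapAvoiding.step_div (hl1 : 0.42618 ≤ l) (hl2 : l ≤ 0.43486) {k : ℕ} (hk : k ≤ 39)
    {u : ℝ} (hu : 0 ≤ u) (h : GapAvoiding l (k + 31) u) :
    GapAvoiding l k |u - l * (base ^ (k + 31) - base ^ k) / 2| ∨
      GapAvoiding l k (u + l * (base ^ (k + 31) - base ^ k) / 2) := by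
  have shift : ∀ {a b : ℝ}, 0 ≤ a → a ≤ base ^ (k + 31) - base ^ k →
      base ^ (k + 31) - base ^ k ≤ b →
      l * a / 2 ≤ l * (base ^ (k + 31) - base ^ k) / 2 ∧
        l * (base ^ (k + 31) - base ^ k) / 2 ≤ l * b / 2 := fun _ ha hb => by
    have hl : 0 ≤ l := by linarith
    constructor <;> gcongr
  by_cases k0 : k = 0
  · subst k0
    obtain ⟨h1, h2⟩ := shift (a := 1.66302) (b := 1.66303) (by norm_num) (by norm_num [base])
      (by norm_num [base])
    generalize l * (base ^ (0 + 31) - base ^ 0) / 2 = d at *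
    norm_num [GapAvoiding] at h ⊢
    rcases h with h | ⟨h, h'⟩
    · right; constructor <;> linarith
    · rw [abs_of_nonneg (by linarith)]
      left; constructor <;> linarith
  by_cases k31 : k = 31
  · subst k31
    obtain ⟨h1, h2⟩ := shift (a := 4.42866) (b := 4.42868) (by norm_num) (by norm_num [base])
      (by norm_num [base])
    generalize l * (base ^ (31 + 31) - base ^ 31) / 2 = d at *
    norm_num [GapAvoiding] at h ⊢
    left
    rcases h with h | ⟨h, h'⟩ | ⟨h, h'⟩
    · rw [abs_of_nonpos (by linarith)]
      right; constructor <;> linarith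
    · left; exact abs_le.2 ⟨by linarith, by linarith⟩
    · rw [abs_of_nonneg (by linarith)]
      right; constructor <;> linarith
  by_cases k22 : k = 22
  · subst k22
    obtain ⟨h1, h2⟩ := shift (a := 3.33253) (b := 3.33256) (by norm_num) (by norm_num [base])
      (by norm_num [base])
    generalize l * (base ^ (22 + 31) - base ^ 22) / 2 = d at *
    norm_num [GapAvoiding] at h ⊢
    rcases h with h | ⟨h, h'⟩
    · rcases abs_cases (u - d) with ⟨e, _⟩ | ⟨e, _⟩ <;> rw [e]
      · left; left; linarith
      · by_cases c1 : -(u - d) ≤ 0.5229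
        · left; left; linarith
        · by_cases c2 : 0.5306 ≤ -(u - d)
          · left; right; left; constructor <;> linarith
          · right; right; right; constructor <;> linarith
    · rw [abs_of_nonneg (by linarith)]
      left; right; left; constructor <;> linarith
  by_cases k13 : k = 13
  · subst k13
    obtain ⟨h1, h2⟩ := shift (a := 2.50773) (b := 2.50775) (by norm_num) (by norm_num [base])
      (by norm_num [base])
    generalize l * (base ^ (13 + 31) - base ^ 13) / 2 = d at *
    norm_num [GapAvoiding] at h ⊢
    left
    rcases h with h | ⟨h, h'⟩
    · left; exact abs_le.2 ⟨by linarith, by linarith⟩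
    · rw [abs_of_nonneg (by linarith)]
      right; constructor <;> linarith
  · left
    rw [gapAvoiding_iff_of_hull (by omega) (by omega) (by omega) (by omega) (by omega) (by omega)
      (by omega)] at h
    rw [gapAvoiding_iff_of_hull k0 k31 (by omega) k22 (by omega) k13 (by omega), mul_sub]
    refine abs_sub_le_of_hull hu h ?_ ?_
    · unfold hullMargin
      split_ifs <;> first | omega | norm_num
    · have hle : ∀ {j : ℕ}, k ≤ j → l * base ^ k ≤ 0.43486 * base ^ j := fun hj =>
        mul_le_mul hl2 (base_pow_le_base_pow hj) (base_pow_pos _).le (by norm_num)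
      have hq : base ^ 31 ≤ 2.663025 := by norm_num [base]
      have hpos : 0 ≤ l * base ^ k := mul_nonneg (by linarith) (base_pow_pos k).le
      have h1 := mul_le_mul_of_nonneg_left hq hpos
      rw [pow_add, ← mul_assoc]
      by_cases hk35 : k ≤ 35
      · have hm : hullMargin k ≤ 0.0373 := by
          unfold hullMargin
          split_ifs <;> norm_num
        have h35 : base ^ 35 ≤ 3.0218 := by norm_num [base]
        linarith [hle hk35]
      · have hm : hullMargin k ≤ 0.003 := by
          unfold hullMargin
          split_ifs <;> first | omega | norm_num
        have h39 : base ^ 39 ≤ 3.4289 := by norm_num [base]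
        linarith [hle hk]

/-- In the window where a small first-level gap opens, the difference set at level `4` contains
a shortened hull. -/
lemma hasInterval_of_gap (hl1 : 0.42618 ≤ l) (hl2 : l ≤ 0.43486) :
    HasInterval (base ^ 40) (base ^ 31) (l * base ^ 4) := by
  refine ⟨-0.1, 0.1, by norm_num, fun s hs => ?_⟩
  refine isDiff_of_levels (by linarith) (fun k _ u h => GapAvoiding.le_hull hl1 h)
    (fun k hk u hu h => GapAvoiding.step_mul hl1 hl2 hk hu h)
    (fun k hk u hu h => GapAvoiding.step_div hl1 hl2 hk hu h) (by norm_num) ?_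
  rw [gapAvoiding_iff_of_hull (by norm_num) (by norm_num) (by norm_num) (by norm_num)
    (by norm_num) (by norm_num) (by norm_num)]
  have h1 : |s| ≤ 0.1 := abs_le.2 ⟨hs.1.le, hs.2.le⟩
  have h2 : 0 ≤ l * base ^ 4 := mul_nonneg (by linarith) (base_pow_pos 4).le
  norm_num [hullMargin]
  linarith

end gap

lemma HasInterval.of_mul_base_zpow {l : ℝ} (n : ℤ)
    (h : HasInterval (base ^ 40) (base ^ 31) (l * base ^ n)) :
    HasInterval (base ^ 40) (base ^ 31) l := by
  have hp := one_lt_base_pow (n := 40) (by norm_num)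
  have hq := one_lt_base_pow (n := 31) (by norm_num)
  have hb : base ≠ 0 := by linarith [one_lt_base]
  have hmul : ∀ {l : ℝ}, HasInterval (base ^ 40) (base ^ 31) (l * base) →
      HasInterval (base ^ 40) (base ^ 31) l := fun {l} h => by
    refine HasInterval.of_pow_mul_div_pow hp hq 7 9 ?_
    rwa [← pow_mul, ← pow_mul, show (base ^ (40 * 7) * (l / base ^ (31 * 9))) = l * base by
      rw [mul_div_assoc', div_eq_iff (pow_ne_zero _ hb)]; ring]
  have hdiv : ∀ {l : ℝ}, HasInterval (base ^ 40) (base ^ 31) (l * base⁻¹) →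
      HasInterval (base ^ 40) (base ^ 31) l := fun {l} h => by
    refine HasInterval.of_pow_mul_div_pow hp hq 24 31 ?_
    rwa [← pow_mul, ← pow_mul, show (base ^ (40 * 24) * (l / base ^ (31 * 31))) = l * base⁻¹ by
      rw [mul_div_assoc', div_eq_iff (pow_ne_zero _ hb), show 31 * 31 = 40 * 24 + 1 from rfl,
        pow_succ' base (40 * 24), mul_assoc l, inv_mul_cancel_left₀ hb, mul_comm]]
  induction n using Int.induction_on generalizing l with
  | zero => simpa using h
  | succ n ih =>
    refine ih (hmul ?_)
    rwa [mul_assoc, ← zpow_add_one₀ hb]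
  | pred n ih =>
    refine ih (hdiv ?_)
    rwa [mul_assoc, ← zpow_sub_one₀ hb]

lemma hasInterval_of_pos {l : ℝ} (hl : 0 < l) : HasInterval (base ^ 40) (base ^ 31) l := by
  have hb := one_lt_base
  have hp := base_pow_pos 40
  have hq : 0 < base ^ 31 - 2 := by norm_num [base]
  set L := 1 / (base ^ 40 * (base ^ 31 - 2)) with hL
  have hL0 : 0 < L := by positivity
  obtain ⟨n, hn1, hn2⟩ := exists_mem_Ico_zpow (div_pos hl hL0) hb
  have hz : 0 < base ^ n := zpow_pos (by linarith) n
  refine HasInterval.of_mul_base_zpow (-n) ?_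
  rw [zpow_neg, ← div_eq_mul_inv]
  have h1 : L ≤ l / base ^ n := by
    rw [le_div_iff₀ hL0] at hn1
    rw [le_div_iff₀ hz]
    linarith
  have h2 : l / base ^ n < L * base := by
    rw [div_lt_iff₀ hL0, zpow_add_one₀ (by linarith)] at hn2
    rw [div_lt_iff₀ hz]
    linarith
  generalize l / base ^ n = m at h1 h2
  have hL1 : L * (base ^ 40 * (base ^ 31 - 2)) = 1 := by
    rw [hL]; field_simp
  rcases le_or_gt (base ^ 40 - 2) (base ^ 40 * m) with h | h
  · refine hasInterval_of_no_gap h ?_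
    calc m * base ^ 70 * (base ^ 31 - 2) ≤ L * base * base ^ 70 * (base ^ 31 - 2) := by
          have := base_pow_pos 70
          gcongr
      _ = L * (base ^ 40 * (base ^ 31 - 2)) * base ^ 31 := by ring
      _ = base ^ 31 := by rw [hL1, one_mul]
  · refine HasInterval.of_mul_base_zpow 4 (hasInterval_of_gap (l := m) ?_ ?_)
    · refine le_trans ?_ h1
      rw [hL, le_div_iff₀ (by positivity)]
      norm_num [base]
    · obtain ⟨hp1, hp2⟩ := base_pow_forty_mem
      by_contra! hm
      have := mul_lt_mul_of_pos_left hm hp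
      linarith

/-- With `γ = 1.0321`, `p = γ^40`, `q = γ^31` and the middle Cantor sets
`C_p = {(1-1/p) ∑ a_i/p^i : a_i ∈ {0,1}}`, `C_q = {(1-1/q) ∑ a_i/q^i : a_i ∈ {0,1}}`,
the arithmetic difference `C_p - λ C_q` contains a nonempty open interval for every
`λ ≠ 0`. -/
theorem arithmetic_difference_contains_interval :
    let γ : ℝ := 1.0321
    let p : ℝ := γ ^ 40
    let q : ℝ := γ ^ 31
    let Cp : Set ℝ := {x | ∃ a : ℕ → ℝ, (∀ i, a i = 0 ∨ a i = 1) ∧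
      x = (1 - 1 / p) * ∑' i : ℕ, a i / p ^ i}
    let Cq : Set ℝ := {x | ∃ a : ℕ → ℝ, (∀ i, a i = 0 ∨ a i = 1) ∧
      x = (1 - 1 / q) * ∑' i : ℕ, a i / q ^ i}
    ∀ lam : ℝ, lam ≠ 0 →
      ∃ u v : ℝ, u < v ∧
        Set.Ioo u v ⊆ {z | ∃ x ∈ Cp, ∃ y ∈ Cq, z = x - lam * y} := by
  intro γ p q Cp Cq lam hlam
  change ∃ u v : ℝ, u < v ∧ Ioo u v ⊆ {z | ∃ x ∈ middleCantor (base ^ 40),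
    ∃ y ∈ middleCantor (base ^ 31), z = x - lam * y}
  obtain ⟨u, v, huv, h⟩ := hasInterval_of_pos (abs_pos.2 hlam)
  refine ⟨u + (1 - lam) / 2, v + (1 - lam) / 2, by linarith, fun z hz => ?_⟩
  obtain ⟨x, hx, y, hy, e⟩ := h (show z - (1 - lam) / 2 ∈ Ioo u v from
    ⟨by linarith [hz.1], by linarith [hz.2]⟩)
  rcases abs_cases lam with ⟨hs, -⟩ | ⟨hs, -⟩ <;> rw [hs] at e
  · exact ⟨x, hx, y, hy, by linarith⟩
  · exact ⟨x, hx, 1 - y, one_sub_mem_middleCantor (one_lt_base_pow (by norm_num)) hy, by linarith⟩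
end
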